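/- arXiv:2307.11231 — 12 statements merged into one kernel-verified Lean document; each statement's English description precedes it below -/
import Mathlib

section
/- There exists a constant c > 0 such that for all nonzero integers n1, n2, n3 with |n1| ≥ |n2| ≥ |n3| and n := n1 + n2 + n3, at least one of the following holds: (I) n_i = n for some 1 ≤ i ≤ 3 (resonance); (II) |n3| ≥ c·|n1|; (III) |n^5 − n1^5 − n2^5 − n3^5| ≥ c·n1^4. -/
/-- The quintic resonance function in three variables splits into the three pairwise sums and
a positive definite quadratic form. -/
lemma quintic_phase_factor {R : Type*} [CommRing R] (a b c : R) :
    (a + b + c) ^ 5 - a ^ 5 - b ^ 5 - c ^ 5 =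
      5 * ((a + b) * (b + c) * (a + c) *
        (a ^ 2 + b ^ 2 + c ^ 2 + a * b + b * c + a * c)) := by
  ring

/-- For nonzero integers, twice the absolute value of the product dominates the difference. -/
lemma abs_sub_le_two_mul_abs_mul {x y : ℤ} (hx : x ≠ 0) (hy : y ≠ 0) :
    |x - y| ≤ 2 * |x * y| := by
  have hx1 := Int.one_le_abs hx
  have hy1 := Int.one_le_abs hy
  rw [abs_mul]
  nlinarith [abs_sub x y]

lemma quintic_phase_lower_bound {a b c : ℤ} (hab : a + b ≠ 0) (hbc : b + c ≠ 0)
    (hc : 2 * |c| ≤ |a|) :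
    a ^ 4 ≤ 64 * |(a + b + c) ^ 5 - a ^ 5 - b ^ 5 - c ^ 5| := by
  have hprod : |a| ≤ 4 * |(a + b) * (b + c)| := by
    have h := abs_sub_le_two_mul_abs_mul hab hbc
    have h' := abs_sub_abs_le_abs_sub a c
    rw [show a + b - (b + c) = a - c by ring] at h
    linarith
  have hsum : |a| ≤ 2 * |a + c| := by
    have h := abs_sub_abs_le_abs_sub a (-c)
    rw [abs_neg, sub_neg_eq_add] at h
    linarith
  have hquad : a ^ 2 ≤ 8 * |a ^ 2 + b ^ 2 + c ^ 2 + a * b + b * c + a * c| := by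
    have h : |a| ^ 2 ≤ (2 * |a + c|) ^ 2 := by gcongr
    rw [mul_pow, sq_abs, sq_abs] at h
    have h' := le_abs_self (a ^ 2 + b ^ 2 + c ^ 2 + a * b + b * c + a * c)
    nlinarith [sq_nonneg (a + b), sq_nonneg (b + c)]
  rw [quintic_phase_factor, abs_mul, abs_mul _ (a ^ 2 + _ + _ + _ + _ + _), abs_mul _ (a + c)]
  calc a ^ 4 = |a| * |a| * a ^ 2 := by rw [abs_mul_abs_self]; ring
    _ ≤ 4 * |(a + b) * (b + c)| * (2 * |a + c|) *
        (8 * |a ^ 2 + b ^ 2 + c ^ 2 + a * b + b * c + a * c|) := by gcongr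
    _ = 64 * (|(a + b) * (b + c)| * |a + c| *
        |a ^ 2 + b ^ 2 + c ^ 2 + a * b + b * c + a * c|) := by ring
    _ ≤ _ := mul_le_mul_of_nonneg_left
      (le_mul_of_one_le_left (by positivity) (by norm_num)) (by norm_num)

/-- Proposition "small symbol decomp": there is c > 0 such that for all nonzero
integers n₁, n₂, n₃ with |n₁| ≥ |n₂| ≥ |n₃| and n = n₁+n₂+n₃, either a resonance
nᵢ = n occurs, or |n₃| ≥ c·|n₁|, or |n⁵ - n₁⁵ - n₂⁵ - n₃⁵| ≥ c·n₁⁴. -/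
theorem small_symbol_decomp :
    ∃ c : ℝ, 0 < c ∧
      ∀ n1 n2 n3 : ℤ, n1 ≠ 0 → n2 ≠ 0 → n3 ≠ 0 → |n2| ≤ |n1| → |n3| ≤ |n2| →
        (n1 = n1 + n2 + n3 ∨ n2 = n1 + n2 + n3 ∨ n3 = n1 + n2 + n3) ∨
        c * |(n1 : ℝ)| ≤ |(n3 : ℝ)| ∨
        c * (n1 : ℝ) ^ 4 ≤
          |(((n1 + n2 + n3) ^ 5 - n1 ^ 5 - n2 ^ 5 - n3 ^ 5 : ℤ) : ℝ)| := by
  refine ⟨1 / 64, by norm_num, fun n1 n2 n3 _ _ _ _ _ => ?_⟩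
  by_cases hres : n1 = n1 + n2 + n3 ∨ n2 = n1 + n2 + n3 ∨ n3 = n1 + n2 + n3
  · exact Or.inl hres
  refine Or.inr (or_iff_not_imp_left.mpr fun hcomp => ?_)
  have hsmall : 2 * |n3| ≤ |n1| := by
    have h : (2 : ℝ) * |(n3 : ℝ)| ≤ |(n1 : ℝ)| := by linarith [abs_nonneg (n3 : ℝ)]
    exact_mod_cast h
  have h : ((n1 ^ 4 : ℤ) : ℝ) ≤
      ((64 * |(n1 + n2 + n3) ^ 5 - n1 ^ 5 - n2 ^ 5 - n3 ^ 5| : ℤ) : ℝ) :=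
    Int.cast_le.mpr (quintic_phase_lower_bound (by omega) (by omega) hsmall)
  rw [Int.cast_mul, Int.cast_abs, Int.cast_pow, Int.cast_ofNat] at h
  linarith
end

section
/- For every real s > 1/2, every ε with 0 ≤ ε ≤ 1, and every c > 0, there exists a constant C > 0 with the following property. For every finitely supported function a : ℤ → [0,∞) with a(0) = 0, one has ( Σ_{n ≠ 0} ⟨n⟩^{2(s+ε)} · ( Σ ' |n|·(n1^2 + (n2+n3)^2)·|n2+n3|·(n2^2+n3^2) / (|Φ2(n1, n2+n3)|·|Φ3(n1,n2,n3)|) · a(n1)·a(n2)·a(n3) )^2 )^{1/2} ≤ C·( Σ_n ⟨n⟩^{2s} a(n)^2 )^{3/2}, where the inner sum Σ ' runs over all triples of nonzero integers (n1,n2,n3) with n1 + n2 + n3 = n, n2 + n3 ≠ 0, and |Φ3(n1,n2,n3)| ≥ c·max(|n1|,|n2|,|n3|)^4. -/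
/-- Φ₂(a,b) = (a+b)⁵ - a⁵ - b⁵. -/
def Phi2 (a b : ℤ) : ℤ := (a + b) ^ 5 - a ^ 5 - b ^ 5

/-- Φ₃(a,b,c) = (a+b+c)⁵ - a⁵ - b⁵ - c⁵. -/
def Phi3 (a b c : ℤ) : ℤ := (a + b + c) ^ 5 - a ^ 5 - b ^ 5 - c ^ 5

lemma abs_Phi2_cast_ge (x m : ℤ) :
    5 / 2 * (|(x : ℝ)| * |(m : ℝ)| * |(x : ℝ) + m| * ((x : ℝ) ^ 2 + (m : ℝ) ^ 2)) ≤
      |((Phi2 x m : ℤ) : ℝ)| := by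
  have hfac : ((Phi2 x m : ℤ) : ℝ) =
      5 * ((x : ℝ) * m * (x + m)) * ((x : ℝ) ^ 2 + x * m + (m : ℝ) ^ 2) := by
    unfold Phi2
    push_cast
    ring
  have hq : ((x : ℝ) ^ 2 + (m : ℝ) ^ 2) / 2 ≤ (x : ℝ) ^ 2 + x * m + (m : ℝ) ^ 2 := by
    nlinarith [sq_nonneg ((x : ℝ) + m)]
  have hq0 : 0 ≤ (x : ℝ) ^ 2 + x * m + (m : ℝ) ^ 2 := le_trans (by positivity) hq
  rw [hfac, abs_mul, abs_mul, abs_mul, abs_mul, abs_of_nonneg hq0, abs_of_pos (show (0 : ℝ) < 5 by norm_num)]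
  have := mul_le_mul_of_nonneg_left hq
    (show 0 ≤ 5 * (|(x : ℝ)| * |(m : ℝ)| * |(x : ℝ) + m|) by positivity)
  linarith

/-- The symbol of the boundary term is `O(M⁻²)` where the trilinear phase is at least `c M⁴`. -/
lemma symbol_le {c M P : ℝ} (hc : 0 < c) (hM : 1 ≤ M) {x y z n : ℤ} (hx : x ≠ 0)
    (hn0 : n ≠ 0) (hn : x + y + z = n) (hyz : y + z ≠ 0) (hy : |(y : ℝ)| ≤ M)
    (hz : |(z : ℝ)| ≤ M) (hP : c * M ^ 4 ≤ P) :
    |(n : ℝ)| * ((x : ℝ) ^ 2 + ((y : ℝ) + (z : ℝ)) ^ 2) * |(y : ℝ) + (z : ℝ)| *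
        ((y : ℝ) ^ 2 + (z : ℝ) ^ 2) / (|((Phi2 x (y + z) : ℤ) : ℝ)| * P) ≤
      4 / (5 * c) / M ^ 2 := by
  have hB := abs_Phi2_cast_ge x (y + z)
  have hnr : (x : ℝ) + ((y + z : ℤ) : ℝ) = n := by rw [← hn]; push_cast; ring
  rw [hnr] at hB
  push_cast at hB
  have hM0 : 0 < M := by linarith
  have hx1 : (1 : ℝ) ≤ |(x : ℝ)| := by exact_mod_cast Int.one_le_abs hx
  have hm0 : 0 < |(y : ℝ) + z| := by
    rw [abs_pos]
    exact_mod_cast hyz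
  have hn1 : 0 < |(n : ℝ)| := by
    rw [abs_pos]
    exact_mod_cast hn0
  have hP0 : 0 < P := lt_of_lt_of_le (by positivity) hP
  have hq : 0 < (x : ℝ) ^ 2 + ((y : ℝ) + z) ^ 2 := by
    have : (x : ℝ) ≠ 0 := by exact_mod_cast hx
    positivity
  set R : ℝ := |(n : ℝ)| * |(y : ℝ) + z| * ((x : ℝ) ^ 2 + ((y : ℝ) + z) ^ 2) with hR
  have hR0 : 0 < R := by positivity
  have hBR : 5 / 2 * R ≤ |((Phi2 x (y + z) : ℤ) : ℝ)| := by
    refine le_trans ?_ hB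
    have := mul_le_mul_of_nonneg_right hx1 hR0.le
    rw [hR] at this ⊢
    linarith
  have hyz2 : (y : ℝ) ^ 2 + (z : ℝ) ^ 2 ≤ 2 * M ^ 2 := by
    have h1 := sq_le_sq' (by linarith [abs_nonneg (y : ℝ)]) hy
    have h2 := sq_le_sq' (by linarith [abs_nonneg (z : ℝ)]) hz
    rw [sq_abs] at h1 h2
    linarith
  calc _ = R * ((y : ℝ) ^ 2 + (z : ℝ) ^ 2) / (|((Phi2 x (y + z) : ℤ) : ℝ)| * P) := by
        rw [hR]; ring
    _ ≤ R * (2 * M ^ 2) / ((5 / 2 * R) * (c * M ^ 4)) := by gcongr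
    _ = 4 / (5 * c) / M ^ 2 := by field_simp; ring

lemma summable_one_add_sq_rpow_neg {s : ℝ} (hs : 1 / 2 < s) :
    Summable fun n : ℤ => ((1 + (n : ℝ) ^ 2) ^ s)⁻¹ := by
  refine Summable.of_norm_bounded_eventually
    (Real.summable_abs_int_rpow (b := 2 * s) (by linarith)) ?_
  filter_upwards [(Set.finite_singleton (0 : ℤ)).compl_mem_cofinite] with n hn
  have hn0 : 0 < |(n : ℝ)| := by
    rw [abs_pos]
    exact_mod_cast hn
  rw [Real.norm_of_nonneg (by positivity), Real.rpow_neg hn0.le, Real.rpow_mul hn0.le,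
    Real.rpow_two, sq_abs]
  have hsq : 0 < (n : ℝ) ^ 2 := by rw [← sq_abs]; positivity
  gcongr
  linarith

/-- Sobolev weights at frequency `x + y + z` are controlled by those at the largest of
`x, y, z`, with the gain `M⁻⁴` paying for up to one extra derivative. -/
lemma weight_mul_le {s ε : ℝ} (hs : 0 ≤ s) (hε0 : 0 ≤ ε) (hε1 : ε ≤ 1) {x y z n : ℤ} {M : ℝ}
    (hn : x + y + z = n) (hM : 1 ≤ M) (hMd : M = max (max |(x : ℝ)| |(y : ℝ)|) |(z : ℝ)|) :
    (1 + (n : ℝ) ^ 2) ^ (s + ε) * (1 / M ^ 2) ^ 2 ≤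
      10 ^ (s + 1) * ((1 + (x : ℝ) ^ 2) ^ s + (1 + (y : ℝ) ^ 2) ^ s + (1 + (z : ℝ) ^ 2) ^ s) := by
  have hM0 : 0 < M := by linarith
  have hxM : |(x : ℝ)| ≤ M := by rw [hMd]; simp
  have hyM : |(y : ℝ)| ≤ M := by rw [hMd]; simp
  have hzM : |(z : ℝ)| ≤ M := by rw [hMd]; simp
  have hnM : |(n : ℝ)| ≤ 3 * M := by
    rw [← hn]
    push_cast
    linarith [abs_add_three (x : ℝ) y z]
  have hM2 : 1 ≤ M ^ 2 := one_le_pow₀ hM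
  have hn2 : 1 + (n : ℝ) ^ 2 ≤ 10 * M ^ 2 := by
    have := pow_le_pow_left₀ (abs_nonneg _) hnM 2
    rw [sq_abs] at this
    nlinarith
  have h1 : (1 + (n : ℝ) ^ 2) ^ (s + ε) ≤ 10 ^ (s + 1) * ((M ^ 2) ^ s * M ^ 2) := by
    calc (1 + (n : ℝ) ^ 2) ^ (s + ε) ≤ (10 * M ^ 2) ^ (s + ε) := by gcongr
      _ ≤ (10 * M ^ 2) ^ (s + 1) := by
          apply Real.rpow_le_rpow_of_exponent_le <;> linarith
      _ = _ := by
          rw [Real.mul_rpow (by norm_num) (by positivity), Real.rpow_add (x := M ^ 2) (by positivity),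
            Real.rpow_one]
  have h2 : (M ^ 2) ^ s ≤
      (1 + (x : ℝ) ^ 2) ^ s + (1 + (y : ℝ) ^ 2) ^ s + (1 + (z : ℝ) ^ 2) ^ s := by
    have key : ∀ w : ℤ, M = |(w : ℝ)| → (M ^ 2) ^ s ≤ (1 + (w : ℝ) ^ 2) ^ s := by
      intro w hw
      rw [hw, sq_abs]
      gcongr
      linarith
    have px : 0 ≤ (1 + (x : ℝ) ^ 2) ^ s := by positivity
    have py : 0 ≤ (1 + (y : ℝ) ^ 2) ^ s := by positivity
    have pz : 0 ≤ (1 + (z : ℝ) ^ 2) ^ s := by positivity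
    rcases max_choice (max |(x : ℝ)| |(y : ℝ)|) |(z : ℝ)| with h | h
    · rcases max_choice |(x : ℝ)| |(y : ℝ)| with h' | h'
      · linarith [key x (by rw [hMd, h, h'])]
      · linarith [key y (by rw [hMd, h, h'])]
    · linarith [key z (by rw [hMd, h])]
  calc _ ≤ 10 ^ (s + 1) * ((M ^ 2) ^ s * M ^ 2) * (1 / M ^ 2) ^ 2 := by gcongr
    _ = 10 ^ (s + 1) * (M ^ 2) ^ s * (1 / M ^ 2) := by field_simp
    _ ≤ 10 ^ (s + 1) * (M ^ 2) ^ s * 1 := by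
        gcongr
        rw [div_le_one (by positivity)]
        exact hM2
    _ ≤ _ := by rw [mul_one]; gcongr

lemma Finset.sum_comp_le_tsum_of_injOn {α β : Type*} {h : β → ℝ} (hs : Summable h)
    (h0 : ∀ b, 0 ≤ h b) (D : Finset α) (p : α → β) (hp : Set.InjOn p D) :
    ∑ t ∈ D, h (p t) ≤ ∑' b, h b := by
  classical
  rw [← Finset.sum_image (f := h) hp]
  exact hs.sum_le_tsum _ fun b _ => h0 b

/-- Cauchy-Schwarz on the plane `x + y + z = n` for kernels whose weighted square is
bounded by `K * (w x + w y + w z)`. -/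
lemma weighted_sq_sum_le {w : ℤ → ℝ} (hw : ∀ n, 0 < w n) (hsum : Summable fun n => (w n)⁻¹)
    {K W : ℝ} (hK : 0 ≤ K) (hW : 0 ≤ W) (n : ℤ) (D : Finset (ℤ × ℤ × ℤ))
    (hD : ∀ t ∈ D, t.1 + t.2.1 + t.2.2 = n) (k : ℤ × ℤ × ℤ → ℝ) (a : ℤ → ℝ)
    (hk : ∀ t ∈ D, W * k t ^ 2 ≤ K * (w t.1 + w t.2.1 + w t.2.2)) :
    W * (∑ t ∈ D, k t * a t.1 * a t.2.1 * a t.2.2) ^ 2 ≤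
      (3 * K * ∑' q : ℤ × ℤ, (w q.1)⁻¹ * (w q.2)⁻¹) *
        ∑ t ∈ D, (w t.1 * a t.1 ^ 2) * ((w t.2.1 * a t.2.1 ^ 2) * (w t.2.2 * a t.2.2 ^ 2)) := by
  set h : ℤ × ℤ → ℝ := fun q => (w q.1)⁻¹ * (w q.2)⁻¹ with hh
  have hinv : ∀ n, 0 < (w n)⁻¹ := fun n => inv_pos.mpr (hw n)
  have hS : Summable h := hsum.mul_of_nonneg hsum (fun n => (hinv n).le) fun n => (hinv n).le
  have h0 : ∀ q, 0 ≤ h q := fun q => (mul_pos (hinv _) (hinv _)).le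
  have hCS : (∑ t ∈ D, k t * a t.1 * a t.2.1 * a t.2.2) ^ 2 ≤
      (∑ t ∈ D, k t ^ 2 * ((w t.1)⁻¹ * (w t.2.1)⁻¹ * (w t.2.2)⁻¹)) *
        ∑ t ∈ D, (w t.1 * a t.1 ^ 2) * ((w t.2.1 * a t.2.1 ^ 2) * (w t.2.2 * a t.2.2 ^ 2)) := by
    refine Finset.sum_sq_le_sum_mul_sum_of_sq_le_mul D (fun t _ => ?_) (fun t _ => ?_)
      (fun t _ => ?_)
    · have := hinv t.1; have := hinv t.2.1; have := hinv t.2.2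
      positivity
    · have := hw t.1; have := hw t.2.1; have := hw t.2.2
      positivity
    · have := (hw t.1).ne'; have := (hw t.2.1).ne'; have := (hw t.2.2).ne'
      apply le_of_eq
      field_simp
  have hF : 0 ≤ ∑ t ∈ D,
      (w t.1 * a t.1 ^ 2) * ((w t.2.1 * a t.2.1 ^ 2) * (w t.2.2 * a t.2.2 ^ 2)) := by
    refine Finset.sum_nonneg fun t _ => ?_
    have := hw t.1; have := hw t.2.1; have := hw t.2.2
    positivity
  have hker : W * ∑ t ∈ D, k t ^ 2 * ((w t.1)⁻¹ * (w t.2.1)⁻¹ * (w t.2.2)⁻¹) ≤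
      3 * K * ∑' q, h q := by
    have h1 : W * ∑ t ∈ D, k t ^ 2 * ((w t.1)⁻¹ * (w t.2.1)⁻¹ * (w t.2.2)⁻¹) ≤
        ∑ t ∈ D, K * (h (t.2.1, t.2.2) + h (t.1, t.2.2) + h (t.1, t.2.1)) := by
      rw [Finset.mul_sum]
      refine Finset.sum_le_sum fun t ht => ?_
      have p1 := hinv t.1; have p2 := hinv t.2.1; have p3 := hinv t.2.2
      have q1 := (hw t.1).ne'; have q2 := (hw t.2.1).ne'; have q3 := (hw t.2.2).ne'
      have := mul_le_mul_of_nonneg_right (hk t ht)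
        (show 0 ≤ (w t.1)⁻¹ * (w t.2.1)⁻¹ * (w t.2.2)⁻¹ by positivity)
      calc _ = W * k t ^ 2 * ((w t.1)⁻¹ * (w t.2.1)⁻¹ * (w t.2.2)⁻¹) := by ring
        _ ≤ _ := this
        _ = _ := by
          simp only [hh]
          field_simp
    have e1 := Finset.sum_comp_le_tsum_of_injOn hS h0 D (fun t => (t.2.1, t.2.2)) (by
      rintro ⟨x, y, z⟩ ht ⟨x', y', z'⟩ ht' he
      have := hD _ ht; have := hD _ ht'
      simp only [Prod.mk.injEq] at *
      omega)
    have e2 := Finset.sum_comp_le_tsum_of_injOn hS h0 D (fun t => (t.1, t.2.2)) (by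
      rintro ⟨x, y, z⟩ ht ⟨x', y', z'⟩ ht' he
      have := hD _ ht; have := hD _ ht'
      simp only [Prod.mk.injEq] at *
      omega)
    have e3 := Finset.sum_comp_le_tsum_of_injOn hS h0 D (fun t => (t.1, t.2.1)) (by
      rintro ⟨x, y, z⟩ ht ⟨x', y', z'⟩ ht' he
      have := hD _ ht; have := hD _ ht'
      simp only [Prod.mk.injEq] at *
      omega)
    rw [← Finset.mul_sum, Finset.sum_add_distrib, Finset.sum_add_distrib] at h1
    calc _ ≤ _ := h1
      _ ≤ K * (∑' q, h q + ∑' q, h q + ∑' q, h q) := by gcongr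
      _ = _ := by ring
  calc _ ≤ W * _ := mul_le_mul_of_nonneg_left hCS hW
    _ = _ := (mul_assoc _ _ _).symm
    _ ≤ _ := mul_le_mul_of_nonneg_right hker hF

/-- Fourier-side content of the bound ‖B₂(u)‖_{H^{s+ε}} ≲ ‖u‖_{H^s}³: for s > 1/2,
0 ≤ ε ≤ 1, and c > 0, there is C > 0 so that for every finitely supported
a : ℤ → [0,∞) with a(0) = 0,
( Σ_{n≠0} ⟨n⟩^{2(s+ε)} ( Σ' |n|(n₁²+(n₂+n₃)²)|n₂+n₃|(n₂²+n₃²)/(|Φ₂||Φ₃|) a(n₁)a(n₂)a(n₃) )² )^{1/2}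
  ≤ C ( Σ_n ⟨n⟩^{2s} a(n)² )^{3/2},
where Σ' runs over nonzero triples with n₁+n₂+n₃ = n, n₂+n₃ ≠ 0 and
|Φ₃(n₁,n₂,n₃)| ≥ c·max(|n₁|,|n₂|,|n₃|)⁴.  (Here ⟨n⟩^{2σ} = (1+n²)^σ.) -/
theorem B2_bound (s ε : ℝ) (hs : 1 / 2 < s) (hε0 : 0 ≤ ε) (hε1 : ε ≤ 1)
    (c : ℝ) (hc : 0 < c) :
    ∃ C : ℝ, 0 < C ∧
      ∀ a : ℤ → ℝ, (Function.support a).Finite → (∀ n, 0 ≤ a n) → a 0 = 0 →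
        Real.sqrt (∑ᶠ n ∈ {n : ℤ | n ≠ 0},
          (1 + (n : ℝ) ^ 2) ^ (s + ε) *
            (∑ᶠ t ∈ {t : ℤ × ℤ × ℤ | t.1 ≠ 0 ∧ t.2.1 ≠ 0 ∧ t.2.2 ≠ 0 ∧
                t.1 + t.2.1 + t.2.2 = n ∧ t.2.1 + t.2.2 ≠ 0 ∧
                c * ((max (max |t.1| |t.2.1|) |t.2.2| : ℤ) : ℝ) ^ 4 ≤
                  |((Phi3 t.1 t.2.1 t.2.2 : ℤ) : ℝ)|},
              (|(n : ℝ)| * ((t.1 : ℝ) ^ 2 + ((t.2.1 : ℝ) + (t.2.2 : ℝ)) ^ 2) *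
                  |(t.2.1 : ℝ) + (t.2.2 : ℝ)| * ((t.2.1 : ℝ) ^ 2 + (t.2.2 : ℝ) ^ 2) /
                  (|((Phi2 t.1 (t.2.1 + t.2.2) : ℤ) : ℝ)| *
                    |((Phi3 t.1 t.2.1 t.2.2 : ℤ) : ℝ)|)) *
                a t.1 * a t.2.1 * a t.2.2) ^ 2) ≤
        C * (∑ᶠ n : ℤ, (1 + (n : ℝ) ^ 2) ^ s * a n ^ 2) ^ ((3 : ℝ) / 2) := by
  classical
  set w : ℤ → ℝ := fun n => (1 + (n : ℝ) ^ 2) ^ s with hwd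
  have hw : ∀ n, 0 < w n := fun n => by simp only [hwd]; positivity
  have hsum : Summable fun n => (w n)⁻¹ := summable_one_add_sq_rpow_neg hs
  set K : ℝ := (4 / (5 * c)) ^ 2 * 10 ^ (s + 1) with hKd
  have hK : 0 ≤ K := by positivity
  set Q : ℝ := 3 * K * ∑' q : ℤ × ℤ, (w q.1)⁻¹ * (w q.2)⁻¹ with hQd
  have hQ : 0 ≤ Q := by
    refine mul_nonneg (by positivity) (tsum_nonneg fun q => ?_)
    have := hw q.1; have := hw q.2
    positivity
  refine ⟨√Q + 1, by positivity, fun a hfin _ _ => ?_⟩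
  set A := hfin.toFinset with hA
  have hmem : ∀ {n}, a n ≠ 0 → n ∈ A := fun h => hfin.mem_toFinset.mpr h
  set X : ℝ := ∑ n ∈ A, w n * a n ^ 2 with hXd
  have hX : 0 ≤ X := Finset.sum_nonneg fun n _ => mul_nonneg (hw n).le (sq_nonneg _)
  have hXeq : ∑ᶠ n : ℤ, (1 + (n : ℝ) ^ 2) ^ s * a n ^ 2 = X := by
    refine finsum_eq_sum_of_support_subset _ fun n hn => ?_
    refine hmem fun h0 => hn ?_
    simp [h0]
  set T := A ×ˢ (A ×ˢ A) with hT
  set F : ℤ × ℤ × ℤ → ℝ := fun t =>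
    (w t.1 * a t.1 ^ 2) * ((w t.2.1 * a t.2.1 ^ 2) * (w t.2.2 * a t.2.2 ^ 2)) with hFd
  have hF : ∀ t, 0 ≤ F t := fun t => by
    have := hw t.1; have := hw t.2.1; have := hw t.2.2
    simp only [hFd]
    positivity
  have hFsum : ∑ t ∈ T, F t = X ^ 3 := by
    rw [hT, hXd, Finset.sum_product]
    simp only [hFd, ← Finset.mul_sum]
    rw [← Finset.sum_mul, Finset.sum_product]
    simp only [← Finset.mul_sum]
    rw [← Finset.sum_mul]
    ring
  rw [hXeq]
  set P : ℤ → Set (ℤ × ℤ × ℤ) := fun n => {t : ℤ × ℤ × ℤ | t.1 ≠ 0 ∧ t.2.1 ≠ 0 ∧ t.2.2 ≠ 0 ∧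
                t.1 + t.2.1 + t.2.2 = n ∧ t.2.1 + t.2.2 ≠ 0 ∧
                c * ((max (max |t.1| |t.2.1|) |t.2.2| : ℤ) : ℝ) ^ 4 ≤
                  |((Phi3 t.1 t.2.1 t.2.2 : ℤ) : ℝ)|} with hPd
  set k : ℤ → ℤ × ℤ × ℤ → ℝ := fun n t =>
    (|(n : ℝ)| * ((t.1 : ℝ) ^ 2 + ((t.2.1 : ℝ) + (t.2.2 : ℝ)) ^ 2) *
                  |(t.2.1 : ℝ) + (t.2.2 : ℝ)| * ((t.2.1 : ℝ) ^ 2 + (t.2.2 : ℝ) ^ 2) /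
                  (|((Phi2 t.1 (t.2.1 + t.2.2) : ℤ) : ℝ)| *
                    |((Phi3 t.1 t.2.1 t.2.2 : ℤ) : ℝ)|)) with hkd
  have hin : ∀ n, ∑ᶠ t ∈ P n, k n t * a t.1 * a t.2.1 * a t.2.2 =
      ∑ t ∈ T with t ∈ P n, k n t * a t.1 * a t.2.1 * a t.2.2 := by
    intro n
    refine finsum_mem_eq_sum_of_inter_support_eq _ ?_
    ext t
    simp only [Set.mem_inter_iff, Finset.coe_filter, Set.mem_ofPred_eq, Function.mem_support,
      and_congr_left_iff]
    intro ht
    refine ⟨fun h => ⟨?_, h⟩, fun h => h.2⟩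
    simp only [mul_ne_zero_iff] at ht
    exact Finset.mem_product.mpr ⟨hmem ht.1.1.2, Finset.mem_product.mpr ⟨hmem ht.1.2, hmem ht.2⟩⟩
  have hterm : ∀ n : ℤ, n ≠ 0 → (1 + (n : ℝ) ^ 2) ^ (s + ε) *
      (∑ t ∈ T with t ∈ P n, k n t * a t.1 * a t.2.1 * a t.2.2) ^ 2 ≤
        Q * ∑ t ∈ T with t.1 + t.2.1 + t.2.2 = n, F t := by
    intro n hn
    refine (weighted_sq_sum_le hw hsum hK (by positivity) n _
      (fun t ht => (Finset.mem_filter.mp ht).2.2.2.2.1) (k n) a fun t ht => ?_).trans ?_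
    · obtain ⟨hx, hy, hz, hsumt, hyz, hphi⟩ := (Finset.mem_filter.mp ht).2
      set M : ℝ := ((max (max |t.1| |t.2.1|) |t.2.2| : ℤ) : ℝ) with hM
      have hMd : M = max (max |(t.1 : ℝ)| |(t.2.1 : ℝ)|) |(t.2.2 : ℝ)| := by
        rw [hM]; push_cast; rfl
      have hx1 : (1 : ℝ) ≤ |(t.1 : ℝ)| := by exact_mod_cast Int.one_le_abs hx
      have hM1 : 1 ≤ M := by rw [hMd]; simp [hx1]
      have hsym : k n t ≤ 4 / (5 * c) / M ^ 2 :=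
        symbol_le hc hM1 hx hn hsumt hyz (by rw [hMd]; simp) (by rw [hMd]; simp) hphi
      have hk0 : 0 ≤ k n t := by simp only [hkd]; positivity
      calc (1 + (n : ℝ) ^ 2) ^ (s + ε) * k n t ^ 2
          ≤ (1 + (n : ℝ) ^ 2) ^ (s + ε) * (4 / (5 * c) / M ^ 2) ^ 2 := by gcongr
        _ = (4 / (5 * c)) ^ 2 * ((1 + (n : ℝ) ^ 2) ^ (s + ε) * (1 / M ^ 2) ^ 2) := by ring
        _ ≤ (4 / (5 * c)) ^ 2 * (10 ^ (s + 1) * (w t.1 + w t.2.1 + w t.2.2)) := by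
            exact mul_le_mul_of_nonneg_left
              (weight_mul_le (by linarith only [hs]) hε0 hε1 hsumt hM1 hMd) (sq_nonneg _)
        _ = _ := by rw [hKd]; ring
    · refine mul_le_mul_of_nonneg_left (Finset.sum_le_sum_of_subset_of_nonneg ?_
        fun t _ _ => hF t) hQ
      intro t ht
      exact Finset.mem_filter.mpr
        ⟨(Finset.mem_filter.mp ht).1, (Finset.mem_filter.mp ht).2.2.2.2.1⟩
  have hout : ∑ᶠ n ∈ {n : ℤ | n ≠ 0}, (1 + (n : ℝ) ^ 2) ^ (s + ε) *
      (∑ᶠ t ∈ P n, k n t * a t.1 * a t.2.1 * a t.2.2) ^ 2 ≤ Q * X ^ 3 := by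
    simp only [hin]
    set N := T.image fun t => t.1 + t.2.1 + t.2.2 with hN
    rw [finsum_mem_eq_sum_of_inter_support_eq (t := N.filter (· ≠ 0))]
    · calc _ ≤ ∑ n ∈ N with n ≠ 0, Q * ∑ t ∈ T with t.1 + t.2.1 + t.2.2 = n, F t :=
            Finset.sum_le_sum fun n hn => hterm n (Finset.mem_filter.mp hn).2
        _ ≤ ∑ n ∈ N, Q * ∑ t ∈ T with t.1 + t.2.1 + t.2.2 = n, F t :=
            Finset.sum_le_sum_of_subset_of_nonneg (Finset.filter_subset _ _)
              fun n _ _ => mul_nonneg hQ (Finset.sum_nonneg fun t _ => hF t)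
        _ = Q * X ^ 3 := by
            rw [← Finset.mul_sum, Finset.sum_fiberwise_of_maps_to
              (fun t ht => Finset.mem_image_of_mem _ ht), hFsum]
    · ext n
      simp only [Set.mem_inter_iff, Finset.coe_filter, Set.mem_ofPred_eq, Function.mem_support,
        and_congr_left_iff]
      intro hne
      refine ⟨fun h => ⟨?_, h⟩, fun h => h.2⟩
      by_contra hnN
      refine hne ?_
      rw [Finset.sum_eq_zero, zero_pow two_ne_zero, mul_zero]
      intro t ht
      exact absurd (Finset.mem_image.mpr
        ⟨t, (Finset.mem_filter.mp ht).1, (Finset.mem_filter.mp ht).2.2.2.2.1⟩) hnN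
  calc _ ≤ √(Q * X ^ 3) := Real.sqrt_le_sqrt hout
    _ = √Q * X ^ ((3 : ℝ) / 2) := by
        rw [Real.sqrt_mul hQ, Real.sqrt_eq_rpow (X ^ 3), ← Real.rpow_natCast X 3,
          ← Real.rpow_mul hX]
        norm_num
    _ ≤ (√Q + 1) * X ^ ((3 : ℝ) / 2) := by
        gcongr
        linarith
end

section
/- For every c > 0 there exists C > 0 with the following property. Let n1, n2, n3, n4 be nonzero integers with n := n1+n2+n3+n4 ≠ 0, n1 + n2 ≠ 0, n3 + n4 ≠ 0, and |Φ3(n1+n2, n3, n4)| ≥ c·max(|n1+n2|, |n3|, |n4|)^4. Then the symbol m_{D1} := n·((n1+n2)^2+(n3+n4)^2)·(n3+n4)·(n3^2+n4^2)·(n1+n2)·(n1^2+n2^2) / (Φ2(n1+n2, n3+n4)·Φ3(n1+n2, n3, n4)) satisfies |m_{D1}| ≤ C·max(n1^2, n2^2) / max(|n1+n2|, |n3|, |n4|)^2. -/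
/-- The factorization of `Φ₂`, with denominators cleared. -/
lemma two_mul_Phi2 (a b : ℤ) :
    2 * Phi2 a b = 5 * ((a + b) * a * b) * ((a + b) ^ 2 + a ^ 2 + b ^ 2) := by
  unfold Phi2
  ring

/-- The symbol bound over `ℝ`, with `P` and `F` in the roles of `Φ₂` and `Φ₃`. -/
lemma abs_symbol_div_le {c s a b x y u v P F M K : ℝ} (hc : 0 < c) (hM : 0 < M)
    (hs : s ≠ 0) (ha : a ≠ 0) (hb : b ≠ 0)
    (hP : 2 * P = 5 * (s * a * b) * (s ^ 2 + a ^ 2 + b ^ 2))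
    (hx : x ^ 2 ≤ M ^ 2) (hy : y ^ 2 ≤ M ^ 2) (hu : u ^ 2 ≤ K) (hv : v ^ 2 ≤ K)
    (hF : c * M ^ 4 ≤ |F|) :
    |s * (a ^ 2 + b ^ 2) * b * (x ^ 2 + y ^ 2) * a * (u ^ 2 + v ^ 2) / (P * F)| ≤
      8 / (5 * c) * K / M ^ 2 := by
  set Q := s ^ 2 + a ^ 2 + b ^ 2 with hQ
  set T := |s * a * b|
  have hQpos : 0 < Q := by positivity
  have hT : 0 < T := by positivity
  have hFpos : 0 < |F| := lt_of_lt_of_le (by positivity) hF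
  have hK : 0 ≤ K := (sq_nonneg u).trans hu
  have hPabs : |P| = 5 / 2 * (T * Q) := by
    rw [show P = 5 / 2 * (s * a * b * Q) by linarith, abs_mul, abs_mul (s * a * b),
      abs_of_pos hQpos, abs_of_pos (by norm_num : (0 : ℝ) < 5 / 2)]
  have hnum : |s * (a ^ 2 + b ^ 2) * b * (x ^ 2 + y ^ 2) * a * (u ^ 2 + v ^ 2)| ≤
      T * (Q * (2 * M ^ 2) * (2 * K)) := by
    rw [show s * (a ^ 2 + b ^ 2) * b * (x ^ 2 + y ^ 2) * a * (u ^ 2 + v ^ 2) =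
      s * a * b * ((a ^ 2 + b ^ 2) * (x ^ 2 + y ^ 2) * (u ^ 2 + v ^ 2)) by ring, abs_mul,
      abs_of_nonneg (by positivity : 0 ≤ (a ^ 2 + b ^ 2) * (x ^ 2 + y ^ 2) * (u ^ 2 + v ^ 2))]
    gcongr
    · linarith [sq_nonneg s]
    · linarith
    · linarith
  rw [abs_div, abs_mul P, hPabs]
  calc _ ≤ T * (Q * (2 * M ^ 2) * (2 * K)) / (5 / 2 * (T * Q) * (c * M ^ 4)) := by gcongr
    _ = 8 / (5 * c) * K / M ^ 2 := by
      field_simp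
      ring

/-- Nonresonant weight bound for m_{D₁}: for every c > 0 there is C > 0 such that for
nonzero integers n₁,…,n₄ with n = n₁+n₂+n₃+n₄ ≠ 0, n₁+n₂ ≠ 0, n₃+n₄ ≠ 0 and
|Φ₃(n₁+n₂,n₃,n₄)| ≥ c·max(|n₁+n₂|,|n₃|,|n₄|)⁴, one has
|m_{D₁}| ≤ C·max(n₁²,n₂²)/max(|n₁+n₂|,|n₃|,|n₄|)². -/
theorem mD1_nonresonant_bound (c : ℝ) (hc : 0 < c) :
    ∃ C : ℝ, 0 < C ∧
      ∀ n1 n2 n3 n4 : ℤ, n1 ≠ 0 → n2 ≠ 0 → n3 ≠ 0 → n4 ≠ 0 →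
        n1 + n2 + n3 + n4 ≠ 0 → n1 + n2 ≠ 0 → n3 + n4 ≠ 0 →
        c * ((max (max |n1 + n2| |n3|) |n4| : ℤ) : ℝ) ^ 4 ≤
          |((Phi3 (n1 + n2) n3 n4 : ℤ) : ℝ)| →
        |(((n1 + n2 + n3 + n4) * ((n1 + n2) ^ 2 + (n3 + n4) ^ 2) * (n3 + n4) *
              (n3 ^ 2 + n4 ^ 2) * (n1 + n2) * (n1 ^ 2 + n2 ^ 2) : ℤ) : ℝ) /
            (((Phi2 (n1 + n2) (n3 + n4) : ℤ) : ℝ) * ((Phi3 (n1 + n2) n3 n4 : ℤ) : ℝ))| ≤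
          C * ((max (n1 ^ 2) (n2 ^ 2) : ℤ) : ℝ) /
            ((max (max |n1 + n2| |n3|) |n4| : ℤ) : ℝ) ^ 2 := by
  refine ⟨8 / (5 * c), by positivity, ?_⟩
  intro n1 n2 n3 n4 _ _ h3 _ hn h12 h34 hF
  set M : ℤ := max (max |n1 + n2| |n3|) |n4|
  have h3M : |n3| ≤ M := (le_max_right _ _).trans (le_max_left _ _)
  have h4M : |n4| ≤ M := le_max_right _ _
  have hM : 0 < M := (abs_pos.mpr h3).trans_le h3M
  have hP := two_mul_Phi2 (n1 + n2) (n3 + n4)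
  rw [← add_assoc (n1 + n2)] at hP
  have hx : n3 ^ 2 ≤ M ^ 2 := sq_le_sq.mpr (h3M.trans (le_abs_self M))
  have hy : n4 ^ 2 ≤ M ^ 2 := sq_le_sq.mpr (h4M.trans (le_abs_self M))
  have hu : n1 ^ 2 ≤ max (n1 ^ 2) (n2 ^ 2) := le_max_left _ _
  have hv : n2 ^ 2 ≤ max (n1 ^ 2) (n2 ^ 2) := le_max_right _ _
  have key := abs_symbol_div_le (s := ((n1 + n2 + n3 + n4 : ℤ) : ℝ))
    (a := ((n1 + n2 : ℤ) : ℝ)) (b := ((n3 + n4 : ℤ) : ℝ)) (x := (n3 : ℝ)) (y := (n4 : ℝ))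
    (u := (n1 : ℝ)) (v := (n2 : ℝ)) (P := ((Phi2 (n1 + n2) (n3 + n4) : ℤ) : ℝ))
    (K := ((max (n1 ^ 2) (n2 ^ 2) : ℤ) : ℝ)) hc
    (by exact_mod_cast hM) (by exact_mod_cast hn) (by exact_mod_cast h12)
    (by exact_mod_cast h34) (by exact_mod_cast hP) (by exact_mod_cast hx)
    (by exact_mod_cast hy) (by exact_mod_cast hu)
    (by exact_mod_cast hv) hF
  exact_mod_cast key
end

section
/- For every c > 0 there exists C > 0 with the following property. Let n1, n2, n3, n4 be nonzero integers with n := n1+n2+n3+n4 ≠ 0, n2 + n3 + n4 ≠ 0, n3 + n4 ≠ 0, and |Φ3(n1, n2, n3+n4)| ≥ c·max(|n1|, |n2|, |n3+n4|)^4. Then the symbol m_{D2} := n·(n1^2+(n2+n3+n4)^2)·(n2+n3+n4)·(n2^2+(n3+n4)^2)·(n3+n4)·(n3^2+n4^2) / (Φ2(n1, n2+n3+n4)·Φ3(n1, n2, n3+n4)) satisfies |m_{D2}| ≤ C·max(n3^2, n4^2) / (|n1|·max(|n1|, |n2|, |n3+n4|)). -/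
theorem two_mul_Phi2_eq (a b : ℤ) :
    2 * Phi2 a b = 5 * ((a + b) * a * b * ((a + b) ^ 2 + a ^ 2 + b ^ 2)) := by
  unfold Phi2
  ring

theorem abs_Phi2_lower_bound (a b : ℤ) :
    5 / 2 * (|(a : ℝ) + b| * |(a : ℝ)| * |(b : ℝ)| * ((a : ℝ) ^ 2 + (b : ℝ) ^ 2)) ≤
      |(Phi2 a b : ℝ)| := by
  have h : (Phi2 a b : ℝ) =
      5 / 2 * (((a : ℝ) + b) * a * b * (((a : ℝ) + b) ^ 2 + a ^ 2 + b ^ 2)) := by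
    have h2 := congrArg (Int.cast : ℤ → ℝ) (two_mul_Phi2_eq a b)
    push_cast at h2
    linarith
  have hq : 0 ≤ ((a : ℝ) + b) ^ 2 + a ^ 2 + b ^ 2 := by positivity
  rw [h, abs_mul, abs_mul, abs_mul, abs_mul, abs_of_nonneg hq,
    abs_of_pos (by norm_num : (0 : ℝ) < 5 / 2)]
  gcongr
  nlinarith [sq_nonneg ((a : ℝ) + b)]

theorem Phi2_ne_zero {a b : ℤ} (ha : a ≠ 0) (hb : b ≠ 0) (hab : a + b ≠ 0) :
    Phi2 a b ≠ 0 := by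
  intro h
  have h2 := two_mul_Phi2_eq a b
  have hq : 0 < (a + b) ^ 2 + a ^ 2 + b ^ 2 := by positivity
  rw [h, mul_zero] at h2
  exact mul_ne_zero (by norm_num) (mul_ne_zero (mul_ne_zero (mul_ne_zero hab ha) hb) hq.ne')
    h2.symm

/-- Nonresonant weight bound for m_{D₂}: for every c > 0 there is C > 0 such that for
nonzero integers n₁,…,n₄ with n = n₁+n₂+n₃+n₄ ≠ 0, n₂+n₃+n₄ ≠ 0, n₃+n₄ ≠ 0 and
|Φ₃(n₁,n₂,n₃+n₄)| ≥ c·max(|n₁|,|n₂|,|n₃+n₄|)⁴, one has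
|m_{D₂}| ≤ C·max(n₃²,n₄²)/(|n₁|·max(|n₁|,|n₂|,|n₃+n₄|)). -/
theorem mD2_nonresonant_bound (c : ℝ) (hc : 0 < c) :
    ∃ C : ℝ, 0 < C ∧
      ∀ n1 n2 n3 n4 : ℤ, n1 ≠ 0 → n2 ≠ 0 → n3 ≠ 0 → n4 ≠ 0 →
        n1 + n2 + n3 + n4 ≠ 0 → n2 + n3 + n4 ≠ 0 → n3 + n4 ≠ 0 →
        c * ((max (max |n1| |n2|) |n3 + n4| : ℤ) : ℝ) ^ 4 ≤
          |((Phi3 n1 n2 (n3 + n4) : ℤ) : ℝ)| →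
        |(((n1 + n2 + n3 + n4) * (n1 ^ 2 + (n2 + n3 + n4) ^ 2) * (n2 + n3 + n4) *
              (n2 ^ 2 + (n3 + n4) ^ 2) * (n3 + n4) * (n3 ^ 2 + n4 ^ 2) : ℤ) : ℝ) /
            (((Phi2 n1 (n2 + n3 + n4) : ℤ) : ℝ) * ((Phi3 n1 n2 (n3 + n4) : ℤ) : ℝ))| ≤
          C * ((max (n3 ^ 2) (n4 ^ 2) : ℤ) : ℝ) /
            (|(n1 : ℝ)| * ((max (max |n1| |n2|) |n3 + n4| : ℤ) : ℝ)) := by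
  refine ⟨2 / c, by positivity, ?_⟩
  intro n1 n2 n3 n4 h1 _ _ _ hn hs _ hPhi
  have hsum : n1 + (n2 + n3 + n4) ≠ 0 := by simpa only [add_assoc] using hn
  have hPhi2 := abs_Phi2_lower_bound n1 (n2 + n3 + n4)
  have hPhi2_pos : 0 < |(Phi2 n1 (n2 + n3 + n4) : ℝ)| :=
    abs_pos.mpr (Int.cast_ne_zero.mpr (Phi2_ne_zero h1 hs hsum))
  have ha : 0 < |(n1 : ℝ)| := abs_pos.mpr (Int.cast_ne_zero.mpr h1)
  generalize Phi2 n1 (n2 + n3 + n4) = p at *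
  generalize Phi3 n1 n2 (n3 + n4) = q at *
  push_cast at *
  set M : ℝ := max (max |(n1 : ℝ)| |(n2 : ℝ)|) |(n3 : ℝ) + n4|
  set μ : ℝ := max ((n3 : ℝ) ^ 2) ((n4 : ℝ) ^ 2)
  have hM1 : |(n1 : ℝ)| ≤ M := (le_max_left _ _).trans (le_max_left _ _)
  have hM2 : |(n2 : ℝ)| ≤ M := (le_max_right _ _).trans (le_max_left _ _)
  have hM3 : |(n3 : ℝ) + n4| ≤ M := le_max_right _ _
  have hM : 0 < M := ha.trans_le hM1
  have hq : 0 < |(q : ℝ)| := lt_of_lt_of_le (by positivity) hPhi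
  have hQ : (n2 : ℝ) ^ 2 + ((n3 : ℝ) + n4) ^ 2 ≤ 2 * M ^ 2 := by
    linarith [sq_le_sq' (abs_le.mp hM2).1 (abs_le.mp hM2).2,
      sq_le_sq' (abs_le.mp hM3).1 (abs_le.mp hM3).2]
  have hR : (n3 : ℝ) ^ 2 + (n4 : ℝ) ^ 2 ≤ 2 * μ := by
    linarith [le_max_left ((n3 : ℝ) ^ 2) ((n4 : ℝ) ^ 2),
      le_max_right ((n3 : ℝ) ^ 2) ((n4 : ℝ) ^ 2)]
  have hμ : 0 ≤ μ := (sq_nonneg (n3 : ℝ)).trans (le_max_left _ _)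
  rw [abs_div, abs_mul (p : ℝ), div_le_div_iff₀ (by positivity) (by positivity)]
  have hadd : (n1 : ℝ) + n2 + n3 + n4 = n1 + (n2 + n3 + n4) := by ring
  simp only [abs_mul, hadd]
  rw [abs_of_nonneg (by positivity : 0 ≤ (n1 : ℝ) ^ 2 + ((n2 : ℝ) + n3 + n4) ^ 2),
    abs_of_nonneg (by positivity : 0 ≤ (n2 : ℝ) ^ 2 + ((n3 : ℝ) + n4) ^ 2),
    abs_of_nonneg (by positivity : 0 ≤ (n3 : ℝ) ^ 2 + (n4 : ℝ) ^ 2)]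
  set P : ℝ := (n1 : ℝ) ^ 2 + ((n2 : ℝ) + n3 + n4) ^ 2
  set N : ℝ := |(n1 : ℝ) + (n2 + n3 + n4)|
  set S : ℝ := |(n2 : ℝ) + n3 + n4|
  have hP : 0 ≤ P := by positivity
  have hN : 0 ≤ N := abs_nonneg _
  have hS : 0 ≤ S := abs_nonneg _
  calc N * P * S * ((n2 : ℝ) ^ 2 + ((n3 : ℝ) + n4) ^ 2) * |(n3 : ℝ) + n4| *
        ((n3 : ℝ) ^ 2 + (n4 : ℝ) ^ 2) * (|(n1 : ℝ)| * M)
      ≤ N * P * S * (2 * M ^ 2) * M * (2 * μ) * (|(n1 : ℝ)| * M) := by gcongr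
    _ = 4 * (N * P * S * |(n1 : ℝ)| * M ^ 4 * μ) := by ring
    _ ≤ 5 * (N * P * S * |(n1 : ℝ)| * M ^ 4 * μ) := by gcongr; norm_num
    _ = 2 / c * μ * (5 / 2 * (N * |(n1 : ℝ)| * S * P) * (c * M ^ 4)) := by
      field_simp
    _ ≤ 2 / c * μ * (|(p : ℝ)| * |(q : ℝ)|) := by gcongr
end

section
/- For every c > 0 there exist constants C > 0 and K ≥ 2 with the following property. Let n, n2, n3, n4 be nonzero integers with n2 + n3 + n4 = 0, n + n2 ≠ 0, n3 + n4 ≠ 0, |Φ3(n+n2, n3, n4)| ≥ c·max(|n+n2|, |n3|, |n4|)^4, and |n| ≥ K·max(|n2|, |n3|, |n4|). Then the resonant symbol m_{A1} := n·((n+n2)^2+(n3+n4)^2)·(n3+n4)·(n3^2+n4^2)·(n+n2)·(n^2+n2^2) / (Φ2(n+n2, n3+n4)·Φ3(n+n2, n3, n4)) satisfies |m_{A1}| ≤ C·max(|n2|, |n3|, |n4|) / |n|. -/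
/-- Factorization of the two-term resonance function. -/
lemma Phi2_eq (a b : ℤ) : Phi2 a b = 5 * a * b * (a + b) * (a ^ 2 + a * b + b ^ 2) := by
  unfold Phi2
  ring

/-- Resonant multiplier bound, Part I: for every c > 0 there are C > 0 and K ≥ 2 so
that for nonzero integers n, n₂, n₃, n₄ with n₂+n₃+n₄ = 0, n+n₂ ≠ 0, n₃+n₄ ≠ 0,
|Φ₃(n+n₂,n₃,n₄)| ≥ c·max(|n+n₂|,|n₃|,|n₄|)⁴, and |n| ≥ K·max(|n₂|,|n₃|,|n₄|),
the resonant symbol m_{A₁} satisfies |m_{A₁}| ≤ C·max(|n₂|,|n₃|,|n₄|)/|n|. -/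
theorem mA1_resonant_bound (c : ℝ) (hc : 0 < c) :
    ∃ C K : ℝ, 0 < C ∧ 2 ≤ K ∧
      ∀ n n2 n3 n4 : ℤ, n ≠ 0 → n2 ≠ 0 → n3 ≠ 0 → n4 ≠ 0 →
        n2 + n3 + n4 = 0 → n + n2 ≠ 0 → n3 + n4 ≠ 0 →
        c * ((max (max |n + n2| |n3|) |n4| : ℤ) : ℝ) ^ 4 ≤
          |((Phi3 (n + n2) n3 n4 : ℤ) : ℝ)| →
        K * ((max (max |n2| |n3|) |n4| : ℤ) : ℝ) ≤ |(n : ℝ)| →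
        |((n * ((n + n2) ^ 2 + (n3 + n4) ^ 2) * (n3 + n4) * (n3 ^ 2 + n4 ^ 2) *
              (n + n2) * (n ^ 2 + n2 ^ 2) : ℤ) : ℝ) /
            (((Phi2 (n + n2) (n3 + n4) : ℤ) : ℝ) * ((Phi3 (n + n2) n3 n4 : ℤ) : ℝ))| ≤
          C * ((max (max |n2| |n3|) |n4| : ℤ) : ℝ) / |(n : ℝ)| := by
  refine ⟨26 / c, 2, by positivity, le_rfl, ?_⟩
  intro n n2 n3 n4 hn _ _ _ hsum ha hb hPhi hK
  have hn_eq : n + n2 + (n3 + n4) = n := by linarith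
  rw [Phi2_eq, hn_eq]
  generalize Phi3 (n + n2) n3 n4 = F at hPhi ⊢
  have hM2 : |(n2 : ℝ)| ≤ ((max (max |n2| |n3|) |n4| : ℤ) : ℝ) := by
    exact_mod_cast (le_max_left _ _).trans (le_max_left _ _)
  have hM3 : |(n3 : ℝ)| ≤ ((max (max |n2| |n3|) |n4| : ℤ) : ℝ) := by
    exact_mod_cast (le_max_right _ _).trans (le_max_left _ _)
  have hM4 : |(n4 : ℝ)| ≤ ((max (max |n2| |n3|) |n4| : ℤ) : ℝ) := by
    exact_mod_cast le_max_right _ _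
  have hA : |(n : ℝ) + n2| ≤ ((max (max |n + n2| |n3|) |n4| : ℤ) : ℝ) := by
    exact_mod_cast (le_max_left _ _).trans (le_max_left _ _)
  generalize ((max (max |n2| |n3|) |n4| : ℤ) : ℝ) = M at *
  generalize ((max (max |n + n2| |n3|) |n4| : ℤ) : ℝ) = A at *
  have hN : 0 < |(n : ℝ)| := by positivity
  have hM0 : 0 ≤ M := (abs_nonneg _).trans hM2
  have hMN : M ≤ |(n : ℝ)| := by linarith
  have hNA : |(n : ℝ)| / 2 ≤ A := by
    have := abs_sub (n + n2 : ℝ) n2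
    rw [add_sub_cancel_right] at this
    linarith
  have hF : c * (|(n : ℝ)| / 2) ^ 4 ≤ |(F : ℝ)| := le_trans (by gcongr) hPhi
  have hF0 : 0 < |(F : ℝ)| := lt_of_lt_of_le (by positivity) hF
  have hP : (0 : ℝ) < |(n : ℝ) * (n + n2) * (n3 + n4)| :=
    abs_pos.mpr (by exact_mod_cast mul_ne_zero (mul_ne_zero hn ha) hb)
  have haR : (n : ℝ) + n2 ≠ 0 := by exact_mod_cast ha
  set a : ℝ := (n : ℝ) + n2 with ha_def
  set b : ℝ := (n3 : ℝ) + n4 with hb_def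
  have hB : 0 < a ^ 2 + a * b + b ^ 2 := by
    have : 0 < a ^ 2 := by positivity
    nlinarith [sq_nonneg (a + b), sq_nonneg b]
  have hAB : a ^ 2 + b ^ 2 ≤ 2 * (a ^ 2 + a * b + b ^ 2) := by
    nlinarith [sq_nonneg (a + b)]
  have h34 : (n3 : ℝ) ^ 2 + (n4 : ℝ) ^ 2 ≤ 2 * M ^ 2 := by
    have h3 := sq_le_sq' (by linarith [neg_abs_le (n3 : ℝ)]) ((le_abs_self _).trans hM3)
    have h4 := sq_le_sq' (by linarith [neg_abs_le (n4 : ℝ)]) ((le_abs_self _).trans hM4)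
    linarith
  have h12 : (n : ℝ) ^ 2 + (n2 : ℝ) ^ 2 ≤ 2 * |(n : ℝ)| ^ 2 := by
    have := sq_le_sq.mpr (hM2.trans hMN)
    rw [sq_abs]
    linarith
  have hnum : ((n * ((n + n2) ^ 2 + (n3 + n4) ^ 2) * (n3 + n4) * (n3 ^ 2 + n4 ^ 2) *
      (n + n2) * (n ^ 2 + n2 ^ 2) : ℤ) : ℝ) =
      (n * a * b) * ((a ^ 2 + b ^ 2) * (n3 ^ 2 + n4 ^ 2) * (n ^ 2 + n2 ^ 2)) := by
    push_cast
    ring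
  have hden : ((5 * (n + n2) * (n3 + n4) * n *
      ((n + n2) ^ 2 + (n + n2) * (n3 + n4) + (n3 + n4) ^ 2) : ℤ) : ℝ) * F =
      (n * a * b) * (5 * (a ^ 2 + a * b + b ^ 2) * F) := by
    push_cast
    ring
  rw [hnum, hden, mul_div_mul_left _ _ (abs_pos.mp hP), abs_div, abs_mul (5 * _) (F : ℝ),
    abs_of_nonneg (by positivity : 0 ≤ (a ^ 2 + b ^ 2) * ((n3 : ℝ) ^ 2 + n4 ^ 2) * (n ^ 2 + n2 ^ 2)),
    abs_of_pos (by positivity : 0 < 5 * (a ^ 2 + a * b + b ^ 2)),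
    div_le_div_iff₀ (by positivity) hN]
  generalize a ^ 2 + a * b + b ^ 2 = B at *
  generalize |(n : ℝ)| = N at *
  calc (a ^ 2 + b ^ 2) * ((n3 : ℝ) ^ 2 + n4 ^ 2) * (n ^ 2 + n2 ^ 2) * N
      ≤ (2 * B) * (2 * M ^ 2) * (2 * N ^ 2) * N := by gcongr
    _ = 8 * B * M * N ^ 3 * M := by ring
    _ ≤ 8 * B * M * N ^ 3 * N := by gcongr
    _ ≤ 65 / 8 * (B * M * N ^ 4) := by
        have : 0 ≤ B * M * N ^ 4 := by positivity
        linarith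
    _ = 26 / c * M * (5 * B * (c * (N / 2) ^ 4)) := by
        field_simp
        ring
    _ ≤ 26 / c * M * (5 * B * |(F : ℝ)|) := by gcongr
end

section
/- There exists a constant C > 0 such that for all integers n, n1, n2, n4 with n1 + n2 + n4 = 0 and |n| ≥ max(|n1|, |n2|, |n4|), one has |Φ2(n1, n2 + n + n4)·Φ3(n1, n2, n + n4) + 25·n^8·n1·n4| ≤ C·|n|^7·|n1|·|n4|·(|n1| + |n4|). -/
/-- With `a = n₁` and `d = n₄`, the cofactor of `-25 n₁ n₄` in the product of phases is
`n⁸` up to an error of relative size `(|n₁| + |n₄|) / |n|`. -/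
theorem abs_pow_eight_sub_cofactor_le {n a d : ℝ} (ha : |a| ≤ |n|) (hd : |d| ≤ |n|) :
    |n ^ 8 - n * ((n - a) ^ 2 * (n ^ 2 - a * n + a ^ 2) * (n + a + d) *
      (n ^ 2 + n * d + a ^ 2 + a * d + d ^ 2))| ≤ 131 * |n| ^ 7 * (|a| + |d|) := by
  set N := |n| with hN
  set S := |a| + |d| with hS
  have ha0 := abs_nonneg a
  have hd0 := abs_nonneg d
  have hN0 : 0 ≤ N := abs_nonneg n
  have hS0 : 0 ≤ S := by positivity
  have hS2 : S ≤ 2 * N := by linarith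
  have haS : |a| ≤ S := by linarith
  have hdS : |d| ≤ S := by linarith
  set A := (n - a) ^ 2 with hA
  set B := n ^ 2 - a * n + a ^ 2 with hB
  set D := n + a + d with hD
  set E := n ^ 2 + n * d + a ^ 2 + a * d + d ^ 2 with hE
  have hA1 : |n ^ 2 - A| ≤ 3 * (N * S) := by
    calc |n ^ 2 - A| = |a| * |2 * n - a| := by rw [← abs_mul, hA]; ring_nf
      _ ≤ S * (3 * N) := by
        gcongr
        calc |2 * n - a| ≤ |2 * n| + |a| := abs_sub _ _
          _ ≤ 3 * N := by rw [abs_mul, abs_two]; linarith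
      _ = 3 * (N * S) := by ring
  have hB1 : |n ^ 2 - B| ≤ 2 * (N * S) := by
    calc |n ^ 2 - B| = |a| * |n - a| := by rw [← abs_mul, hB]; ring_nf
      _ ≤ S * (2 * N) := by
        gcongr
        exact (abs_sub _ _).trans (by linarith)
      _ = 2 * (N * S) := by ring
  have hD1 : |n - D| ≤ S := by
    calc |n - D| = |a + d| := by rw [hD, ← abs_neg]; ring_nf
      _ ≤ S := abs_add_le _ _
  have hE1 : |n ^ 2 - E| ≤ 3 * (N * S) := by
    calc |n ^ 2 - E| = |d * n + (a * (a + d) + d * d)| := by rw [hE, ← abs_neg]; ring_nf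
      _ ≤ |d| * N + (|a| * S + |d| * |d|) := by
        refine (abs_add_le _ _).trans ?_
        rw [abs_mul]
        gcongr
        refine (abs_add_le _ _).trans ?_
        rw [abs_mul, abs_mul]
        gcongr
        exact abs_add_le _ _
      _ ≤ 3 * (N * S) := by nlinarith
  have hA2 : |A| ≤ 4 * N ^ 2 := by
    rw [hA, abs_pow]
    calc |n - a| ^ 2 ≤ (2 * N) ^ 2 := by
          gcongr
          exact (abs_sub _ _).trans (by linarith)
      _ = 4 * N ^ 2 := by ring
  have hB2 : |B| ≤ 3 * N ^ 2 := by
    have h1 : |a * n| ≤ N * N := by rw [abs_mul]; gcongr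
    have h2 : |a ^ 2| ≤ N ^ 2 := by rw [abs_pow]; gcongr
    have h3 : |n ^ 2| = N ^ 2 := abs_pow _ _
    have h4 := abs_add_le (n ^ 2 - a * n) (a ^ 2)
    have h5 := abs_sub (n ^ 2) (a * n)
    linarith
  have hD2 : |D| ≤ 3 * N := (abs_add_three _ _ _).trans (by linarith)
  have key : n ^ 8 - n * (A * B * D * E) =
      n * ((n ^ 2 - A) * n ^ 5 + A * (n ^ 2 - B) * n ^ 3 + A * B * (n - D) * n ^ 2
        + A * B * D * (n ^ 2 - E)) := by ring
  rw [key, abs_mul]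
  calc N * |(n ^ 2 - A) * n ^ 5 + A * (n ^ 2 - B) * n ^ 3 + A * B * (n - D) * n ^ 2
        + A * B * D * (n ^ 2 - E)|
      ≤ N * (|n ^ 2 - A| * N ^ 5 + |A| * |n ^ 2 - B| * N ^ 3 + |A| * |B| * |n - D| * N ^ 2
        + |A| * |B| * |D| * |n ^ 2 - E|) := by
        gcongr
        simp only [hN, ← abs_pow, ← abs_mul]
        refine (abs_add_le _ _).trans ?_
        gcongr
        exact abs_add_three _ _ _
    _ ≤ N * (3 * (N * S) * N ^ 5 + 4 * N ^ 2 * (2 * (N * S)) * N ^ 3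
        + 4 * N ^ 2 * (3 * N ^ 2) * S * N ^ 2
        + 4 * N ^ 2 * (3 * N ^ 2) * (3 * N) * (3 * (N * S))) := by gcongr
    _ = 131 * N ^ 7 * S := by ring

/-- High-frequency expansion of the denominator of the resonant symbol m_{B₃}:
there is C > 0 such that for all integers n, n₁, n₂, n₄ with n₁+n₂+n₄ = 0 and
|n| ≥ max(|n₁|,|n₂|,|n₄|),
|Φ₂(n₁, n₂+n+n₄)·Φ₃(n₁,n₂,n+n₄) + 25·n⁸·n₁·n₄| ≤ C·|n|⁷·|n₁|·|n₄|·(|n₁|+|n₄|). -/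
theorem mB3_denominator_expansion :
    ∃ C : ℝ, 0 < C ∧
      ∀ n n1 n2 n4 : ℤ, n1 + n2 + n4 = 0 → max (max |n1| |n2|) |n4| ≤ |n| →
        (|(Phi2 n1 (n2 + n + n4) * Phi3 n1 n2 (n + n4) + 25 * n ^ 8 * n1 * n4 : ℤ)| : ℝ) ≤
          C * |(n : ℝ)| ^ 7 * |(n1 : ℝ)| * |(n4 : ℝ)| * (|(n1 : ℝ)| + |(n4 : ℝ)|) := by
  refine ⟨3275, by norm_num, fun n n1 n2 n4 h0 hmax => ?_⟩
  obtain ⟨⟨h1, -⟩, h4⟩ : (|n1| ≤ |n| ∧ |n2| ≤ |n|) ∧ |n4| ≤ |n| := by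
    simpa only [max_le_iff] using hmax
  obtain rfl : n2 = -n1 - n4 := by linarith
  have h1' : |(n1 : ℝ)| ≤ |(n : ℝ)| := by exact_mod_cast h1
  have h4' : |(n4 : ℝ)| ≤ |(n : ℝ)| := by exact_mod_cast h4
  have hbound := abs_pow_eight_sub_cofactor_le h1' h4'
  simp only [Phi2, Phi3]
  push_cast
  calc _ = |25 * ((n1 : ℝ) * n4)| * |(n : ℝ) ^ 8 - n * ((n - n1) ^ 2 *
        (n ^ 2 - n1 * n + n1 ^ 2) * (n + n1 + n4) *
        (n ^ 2 + n * n4 + n1 ^ 2 + n1 * n4 + n4 ^ 2))| := by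
        rw [← abs_mul]
        congr 1
        ring
    _ ≤ |25 * ((n1 : ℝ) * n4)| *
        (131 * |(n : ℝ)| ^ 7 * (|(n1 : ℝ)| + |(n4 : ℝ)|)) := by gcongr
    _ = _ := by
        rw [abs_mul, abs_mul, abs_of_pos (by norm_num : (0 : ℝ) < 25)]
        ring
end

section
/- For every finitely supported function a : ℤ → ℂ, the sum of a(n1)·a(n2)·a(n4) / (n1·n4) over all triples (n1, n2, n4) of nonzero integers with n1 + n2 + n4 = 0 equals 0. -/
theorem finsum_eq_zero_of_orbit_sum_eq_zero {α : Type*} (e : α ≃ α) {f : α → ℂ}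
    (hf : (Function.support f).Finite) (h : ∀ x, f x + f (e x) + f (e (e x)) = 0) :
    ∑ᶠ x, f x = 0 := by
  have hf₁ : (Function.support fun x => f (e x)).Finite :=
    hf.preimage (f := e) e.injective.injOn
  have hf₂ : (Function.support fun x => f (e (e x))).Finite :=
    hf₁.preimage (f := e) e.injective.injOn
  have hf₀₁ : (Function.support fun x => f x + f (e x)).Finite :=
    (hf.union hf₁).subset (Function.support_add _ _)
  have hsum : ∑ᶠ x, (f x + f (e x) + f (e (e x))) = 0 := by simp [h]
  rw [finsum_add_distrib hf₀₁ hf₂, finsum_add_distrib hf hf₁,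
    finsum_comp_equiv e (f := fun x => f (e x)), finsum_comp_equiv e (f := f)] at hsum
  linear_combination hsum / 3

/-- Cyclic rotation of the coordinates of a triple. -/
def rotateTriple (α : Type*) : α × α × α ≃ α × α × α where
  toFun t := (t.2.1, t.2.2, t.1)
  invFun t := (t.2.2, t.1, t.2.1)
  left_inv _ := rfl
  right_inv _ := rfl

/-- First cancellation of "Why Resonant Smoother Bound Holds": for any finitely
supported a : ℤ → ℂ, the sum of a(n₁)a(n₂)a(n₄)/(n₁n₄) over nonzero triples with
n₁ + n₂ + n₄ = 0 vanishes. -/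
theorem resonant_smoother_cancellation_one (a : ℤ → ℂ)
    (ha : (Function.support a).Finite) :
    (∑ᶠ t ∈ {t : ℤ × ℤ × ℤ | t.1 ≠ 0 ∧ t.2.1 ≠ 0 ∧ t.2.2 ≠ 0 ∧
        t.1 + t.2.1 + t.2.2 = 0},
      a t.1 * a t.2.1 * a t.2.2 / ((t.1 : ℂ) * (t.2.2 : ℂ))) = 0 := by
  rw [finsum_mem_def]
  refine finsum_eq_zero_of_orbit_sum_eq_zero (rotateTriple ℤ) ?_ ?_
  · refine (ha.prod (ha.prod ha)).subset fun t ht => ?_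
    have ht' := (Set.indicator_apply_ne_zero.mp ht).2
    simp only [Function.mem_support, ne_eq, div_eq_zero_iff, mul_eq_zero, not_or] at ht'
    exact ⟨ht'.1.1.1, ht'.1.1.2, ht'.1.2⟩
  · rintro ⟨x, y, z⟩
    by_cases h : x ≠ 0 ∧ y ≠ 0 ∧ z ≠ 0 ∧ x + y + z = 0
    · obtain ⟨hx, hy, hz, hxyz⟩ := h
      have hyzx : y + z + x = 0 := by linarith
      have hzxy : z + x + y = 0 := by linarith
      have hx' : (x : ℂ) ≠ 0 := by exact_mod_cast hx
      have hy' : (y : ℂ) ≠ 0 := by exact_mod_cast hy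
      have hz' : (z : ℂ) ≠ 0 := by exact_mod_cast hz
      have hsum : (x : ℂ) + y + z = 0 := by exact_mod_cast hxyz
      simp only [rotateTriple, Equiv.coe_fn_mk, Set.indicator_apply, Set.mem_ofPred_eq, ne_eq,
        hx, hy, hz, hxyz, hyzx, hzxy, not_false_eq_true, and_self, if_true]
      have key : a x * a y * a z / ((x : ℂ) * z) + a y * a z * a x / ((y : ℂ) * x) +
          a z * a x * a y / ((z : ℂ) * y) =
          a x * a y * a z * ((x : ℂ) + y + z) / (x * y * z) := by
        field_simp
        ring
      rw [key, hsum, mul_zero, zero_div]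
    · have h₁ : ¬(y ≠ 0 ∧ z ≠ 0 ∧ x ≠ 0 ∧ y + z + x = 0) := by grind
      have h₂ : ¬(z ≠ 0 ∧ x ≠ 0 ∧ y ≠ 0 ∧ z + x + y = 0) := by grind
      simp only [rotateTriple, Equiv.coe_fn_mk, Set.indicator_apply, Set.mem_ofPred_eq,
        if_neg h, if_neg h₁, if_neg h₂, add_zero]
end

section
/- For every finitely supported function a : ℤ → ℂ, the sum of (3·n2 + 6·n4)·a(n1)·a(n2)·a(n4) / (n1·n4) over all triples (n1, n2, n4) of nonzero integers with n1 + n2 + n4 = 0 equals 0. -/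
theorem finsum_eq_zero_of_comp_equiv_eq_neg {α M : Type*} [AddCommGroup M]
    [IsAddTorsionFree M] (e : α ≃ α) {f : α → M} (h : ∀ x, f (e x) = -f x) :
    ∑ᶠ x, f x = 0 := by
  rw [← self_eq_neg, ← finsum_neg_distrib, ← finsum_comp_equiv e]
  exact finsum_congr h

/-- Exchange of the first and last entries of a triple. -/
def swapFirstLast (α : Type*) : α × α × α ≃ α × α × α where
  toFun t := (t.2.2, t.2.1, t.1)
  invFun t := (t.2.2, t.2.1, t.1)
  left_inv _ := rfl
  right_inv _ := rfl


/-- Second cancellation of "Why Resonant Smoother Bound Holds": for any finitely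
supported a : ℤ → ℂ, the sum of (3n₂+6n₄)·a(n₁)a(n₂)a(n₄)/(n₁n₄) over nonzero triples
with n₁ + n₂ + n₄ = 0 vanishes. -/
theorem resonant_smoother_cancellation_two (a : ℤ → ℂ)
    (ha : (Function.support a).Finite) :
    (∑ᶠ t ∈ {t : ℤ × ℤ × ℤ | t.1 ≠ 0 ∧ t.2.1 ≠ 0 ∧ t.2.2 ≠ 0 ∧
        t.1 + t.2.1 + t.2.2 = 0},
      (3 * (t.2.1 : ℂ) + 6 * (t.2.2 : ℂ)) * a t.1 * a t.2.1 * a t.2.2 /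
        ((t.1 : ℂ) * (t.2.2 : ℂ))) = 0 := by
  refine finsum_eq_zero_of_comp_equiv_eq_neg (swapFirstLast ℤ) fun ⟨x, y, z⟩ => ?_
  simp only [swapFirstLast, Equiv.coe_fn_mk, Set.mem_ofPred_eq]
  by_cases h : x ≠ 0 ∧ y ≠ 0 ∧ z ≠ 0 ∧ x + y + z = 0
  · have h' : z ≠ 0 ∧ y ≠ 0 ∧ x ≠ 0 ∧ z + y + x = 0 := by grind
    simp only [finsum_eq_if, if_pos h, if_pos h']
    obtain rfl : y = -x - z := by grind
    push_cast
    rw [mul_comm (z : ℂ) (x : ℂ), ← neg_div]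
    congr 1
    ring
  · have h' : ¬(z ≠ 0 ∧ y ≠ 0 ∧ x ≠ 0 ∧ z + y + x = 0) := by grind
    simp only [finsum_eq_if, if_neg h, if_neg h', neg_zero]
end

section
/- For every c > 0 there exists C > 0 with the following property. Let n1, n2, n3, n4 be nonzero integers with n := n1+n2+n3+n4 ≠ 0, and suppose that the two frequencies of largest magnitude cancel, i.e. there exist indices i ≠ j in {1,2,3,4} with n_i + n_j = 0 and |n_i| = max(|n1|,|n2|,|n3|,|n4|). Then: (a) if in addition n1+n2 ≠ 0, n3+n4 ≠ 0, and |Φ3(n1+n2, n3, n4)| ≥ c·max(|n1+n2|,|n3|,|n4|)^4, the symbol m_{D1} := n·((n1+n2)^2+(n3+n4)^2)·(n3+n4)·(n3^2+n4^2)·(n1+n2)·(n1^2+n2^2)/(Φ2(n1+n2,n3+n4)·Φ3(n1+n2,n3,n4)) satisfies |m_{D1}| ≤ C; (b) if in addition n2+n3+n4 ≠ 0, n3+n4 ≠ 0, and |Φ3(n1, n2, n3+n4)| ≥ c·max(|n1|,|n2|,|n3+n4|)^4, the symbol m_{D2} := n·(n1^2+(n2+n3+n4)^2)·(n2+n3+n4)·(n2^2+(n3+n4)^2)·(n3+n4)·(n3^2+n4^2)/(Φ2(n1,n2+n3+n4)·Φ3(n1,n2,n3+n4))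 satisfies |m_{D2}| ≤ C·n2*, where n2* denotes the second largest among |n1|, |n2|, |n3|, |n4|. -/
/-- The product of frequencies attached to `Phi2` is controlled by `Phi2`. -/
theorem five_mul_abs_le_two_mul_abs_Phi2 (a b : ℤ) :
    5 * |(a + b) * (a ^ 2 + b ^ 2) * b * a| ≤ 2 * |Phi2 a b| := by
  have h : Phi2 a b = 5 * ((a + b) * b * a) * (a ^ 2 + a * b + b ^ 2) := by
    unfold Phi2; ring
  have h1 : (a + b) * (a ^ 2 + b ^ 2) * b * a = (a + b) * b * a * (a ^ 2 + b ^ 2) := by ring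
  have h2 : a ^ 2 + b ^ 2 ≤ 2 * (a ^ 2 + a * b + b ^ 2) := by nlinarith [sq_nonneg (a + b)]
  have h3 : 0 ≤ a ^ 2 + a * b + b ^ 2 := by nlinarith [sq_nonneg a, sq_nonneg b]
  rw [h, h1, abs_mul, abs_mul (5 * _), abs_mul 5, abs_of_nonneg h3,
    abs_of_nonneg (by positivity : 0 ≤ a ^ 2 + b ^ 2), abs_of_nonneg (by norm_num : (0 : ℤ) ≤ 5)]
  nlinarith [mul_le_mul_of_nonneg_left h2 (abs_nonneg ((a + b) * b * a))]

/-- A symbol `k * x / (q * p)` is bounded once `k` is controlled by `q`, and `x` and `p` are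
compared with a common quantity `B`. -/
theorem abs_symbol_le {c : ℝ} (hc : 0 < c) {k x q p t B : ℤ} (ht : 0 ≤ t)
    (hk : 5 * |k| ≤ 2 * |q|) (hx : |x| ≤ t * B) (hp : c * B ≤ |(p : ℝ)|) :
    |((k * x : ℤ) : ℝ) / (q * p)| ≤ 2 * t / (5 * c) := by
  have ht' : (0 : ℝ) ≤ t := by exact_mod_cast ht
  have hk' : 5 * |(k : ℝ)| ≤ 2 * |(q : ℝ)| := by exact_mod_cast hk
  have hx' : |(x : ℝ)| ≤ t * B := by exact_mod_cast hx
  rw [Int.cast_mul]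
  rw [abs_div, abs_mul, abs_mul]
  refine div_le_of_le_mul₀ (by positivity) (by positivity) ?_
  calc |(k : ℝ)| * |(x : ℝ)| ≤ (2 / 5 * |(q : ℝ)|) * (t * (|(p : ℝ)| / c)) := by
        gcongr
        · linarith
        · refine hx'.trans ?_
          gcongr
          rw [le_div_iff₀ hc]; linarith
    _ = 2 * t / (5 * c) * (|(q : ℝ)| * |(p : ℝ)|) := by field_simp

theorem sq_add_sq_le_of_abs_le {x y a b : ℤ} (hx : |x| ≤ a) (hy : |y| ≤ b) :
    x ^ 2 + y ^ 2 ≤ a ^ 2 + b ^ 2 :=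
  add_le_add (sq_le_sq.2 (hx.trans (le_abs_self a))) (sq_le_sq.2 (hy.trans (le_abs_self b)))

/-- A cancelling pair among four integers sits at the first two places, at the last two places, or
has one member among each of these. -/
theorem cancelling_pair_cases {n1 n2 n3 n4 M : ℤ}
    (h : ∃ i j : Fin 4, i ≠ j ∧ ![n1, n2, n3, n4] i + ![n1, n2, n3, n4] j = 0 ∧
      |![n1, n2, n3, n4] i| = M) :
    (n1 + n2 = 0 ∧ |n1| = M ∧ |n2| = M) ∨ (n3 + n4 = 0 ∧ |n3| = M ∧ |n4| = M) ∨
      ((|n1| = M ∨ |n2| = M) ∧ (|n3| = M ∨ |n4| = M)) := by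
  obtain ⟨i, j, hne, hadd, habs⟩ := h
  have habs' : |![n1, n2, n3, n4] j| = M := by
    rw [← habs, eq_neg_of_add_eq_zero_right hadd, abs_neg]
  fin_cases i <;> fin_cases j <;> simp at hne hadd habs habs' <;>
    simp [habs, habs', ← hadd, add_comm]

/-- "Case 3 replacement bounds": for every c > 0 there is C > 0 so that whenever the
two largest (in magnitude) of the nonzero frequencies n₁,…,n₄ (with n = Σnᵢ ≠ 0) sum
to zero, (a) if n₁+n₂ ≠ 0, n₃+n₄ ≠ 0 and |Φ₃(n₁+n₂,n₃,n₄)| ≥ c·max(|n₁+n₂|,|n₃|,|n₄|)⁴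
then |m_{D₁}| ≤ C, and (b) if n₂+n₃+n₄ ≠ 0, n₃+n₄ ≠ 0 and
|Φ₃(n₁,n₂,n₃+n₄)| ≥ c·max(|n₁|,|n₂|,|n₃+n₄|)⁴ then |m_{D₂}| ≤ C·n₂*,
where n₂* = minᵢ maxⱼ≠ᵢ |nⱼ| is the second largest among |n₁|,…,|n₄|. -/
theorem case3_replacement_bounds (c : ℝ) (hc : 0 < c) :
    ∃ C : ℝ, 0 < C ∧
      ∀ n1 n2 n3 n4 : ℤ, n1 ≠ 0 → n2 ≠ 0 → n3 ≠ 0 → n4 ≠ 0 →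
        n1 + n2 + n3 + n4 ≠ 0 →
        (∃ i j : Fin 4, i ≠ j ∧ ![n1, n2, n3, n4] i + ![n1, n2, n3, n4] j = 0 ∧
          |![n1, n2, n3, n4] i| = max (max |n1| |n2|) (max |n3| |n4|)) →
        ((n1 + n2 ≠ 0 → n3 + n4 ≠ 0 →
            c * ((max (max |n1 + n2| |n3|) |n4| : ℤ) : ℝ) ^ 4 ≤
              |((Phi3 (n1 + n2) n3 n4 : ℤ) : ℝ)| →
            |(((n1 + n2 + n3 + n4) * ((n1 + n2) ^ 2 + (n3 + n4) ^ 2) * (n3 + n4) *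
                  (n3 ^ 2 + n4 ^ 2) * (n1 + n2) * (n1 ^ 2 + n2 ^ 2) : ℤ) : ℝ) /
                (((Phi2 (n1 + n2) (n3 + n4) : ℤ) : ℝ) *
                  ((Phi3 (n1 + n2) n3 n4 : ℤ) : ℝ))| ≤ C) ∧
         (n2 + n3 + n4 ≠ 0 → n3 + n4 ≠ 0 →
            c * ((max (max |n1| |n2|) |n3 + n4| : ℤ) : ℝ) ^ 4 ≤
              |((Phi3 n1 n2 (n3 + n4) : ℤ) : ℝ)| →
            |(((n1 + n2 + n3 + n4) * (n1 ^ 2 + (n2 + n3 + n4) ^ 2) * (n2 + n3 + n4) *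
                  (n2 ^ 2 + (n3 + n4) ^ 2) * (n3 + n4) * (n3 ^ 2 + n4 ^ 2) : ℤ) : ℝ) /
                (((Phi2 n1 (n2 + n3 + n4) : ℤ) : ℝ) *
                  ((Phi3 n1 n2 (n3 + n4) : ℤ) : ℝ))| ≤
              C * ((min (min (max (max |n2| |n3|) |n4|) (max (max |n1| |n3|) |n4|))
                     (min (max (max |n1| |n2|) |n4|)
                       (max (max |n1| |n2|) |n3|)) : ℤ) : ℝ))) := by
  refine ⟨8 / c, by positivity, ?_⟩
  intro n1 n2 n3 n4 h1 _ _ _ _ hij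
  set M : ℤ := max (max |n1| |n2|) (max |n3| |n4|) with hM
  have l1 : |n1| ≤ M := by simp [hM]
  have l2 : |n2| ≤ M := by simp [hM]
  have l3 : |n3| ≤ M := by simp [hM]
  have l4 : |n4| ≤ M := by simp [hM]
  have hM0 : 0 < M := (abs_pos.2 h1).trans_le l1
  have hs : |n3 + n4| ≤ 2 * M := (abs_add_le _ _).trans (by linarith)
  have s34 : n3 ^ 2 + n4 ^ 2 ≤ 2 * M ^ 2 := by linarith [sq_add_sq_le_of_abs_le l3 l4]
  have s12 : n1 ^ 2 + n2 ^ 2 ≤ 2 * M ^ 2 := by linarith [sq_add_sq_le_of_abs_le l1 l2]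
  have s234 : n2 ^ 2 + (n3 + n4) ^ 2 ≤ 5 * M ^ 2 := by
    linarith [sq_add_sq_le_of_abs_le l2 hs]
  have hpair := cancelling_pair_cases hij
  refine ⟨fun ha hb hP => ?_, fun ha hb hP => ?_⟩
  · have hB : M ≤ max (max |n1 + n2| |n3|) |n4| := by
      rcases hpair with h | h | ⟨-, h | h⟩
      · exact absurd h.1 ha
      · exact absurd h.1 hb
      · simp [← h]
      · simp [← h]
    have hx : |(n3 ^ 2 + n4 ^ 2) * (n1 ^ 2 + n2 ^ 2)| ≤ 4 * M ^ 4 := by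
      rw [abs_of_nonneg (by positivity)]
      calc _ ≤ 2 * M ^ 2 * (2 * M ^ 2) := by gcongr
        _ = _ := by ring
    have hk := five_mul_abs_le_two_mul_abs_Phi2 (n1 + n2) (n3 + n4)
    have := abs_symbol_le (B := M ^ 4) (t := 4) hc (by norm_num)
      hk hx (le_trans (by rw [Int.cast_pow]; gcongr) hP)
    calc _ = _ := by congr 3; ring
      _ ≤ _ := this
      _ ≤ 8 / c := by push_cast; rw [div_le_div_iff₀ (by positivity) hc]; nlinarith
  · have hB : M ≤ max (max |n1| |n2|) |n3 + n4| := by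
      rcases hpair with h | h | ⟨h | h, -⟩
      · simp [← h.2.1]
      · exact absurd h.1 hb
      · simp [← h]
      · simp [← h]
    have hS : M ≤ min (min (max (max |n2| |n3|) |n4|) (max (max |n1| |n3|) |n4|))
        (min (max (max |n1| |n2|) |n4|) (max (max |n1| |n2|) |n3|)) := by
      simp only [le_min_iff, le_max_iff]
      rcases hpair with ⟨-, h, h'⟩ | ⟨-, h, h'⟩ | ⟨h | h, h' | h'⟩ <;> simp [h, h']
    have hx : |(n2 ^ 2 + (n3 + n4) ^ 2) * (n3 + n4) * (n3 ^ 2 + n4 ^ 2)| ≤ 20 * M * M ^ 4 := by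
      rw [abs_mul, abs_mul, abs_of_nonneg (by positivity : 0 ≤ n2 ^ 2 + (n3 + n4) ^ 2),
        abs_of_nonneg (by positivity : 0 ≤ n3 ^ 2 + n4 ^ 2)]
      calc _ ≤ 5 * M ^ 2 * (2 * M) * (2 * M ^ 2) := by gcongr
        _ = _ := by ring
    have hk : 5 * |(n1 + (n2 + n3 + n4)) * (n1 ^ 2 + (n2 + n3 + n4) ^ 2) * (n2 + n3 + n4)| ≤
        2 * |Phi2 n1 (n2 + n3 + n4)| := by
      refine le_trans ?_ (five_mul_abs_le_two_mul_abs_Phi2 n1 (n2 + n3 + n4))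
      rw [abs_mul _ n1]
      gcongr
      exact le_mul_of_one_le_right (abs_nonneg _) (Int.one_le_abs h1)
    have := abs_symbol_le (B := M ^ 4) (t := 20 * M) hc (by positivity)
      hk hx (le_trans (by rw [Int.cast_pow]; gcongr) hP)
    calc _ = _ := by congr 3; ring
      _ ≤ _ := this
      _ = 8 / c * M := by push_cast; field_simp; ring
      _ ≤ _ := by
        gcongr
end

section
/- For every finitely supported function a : ℤ → ℂ, the sum of a(n1)·a(n2)·a(n4)·a(n5) / (n1·(n4+n5)·n4) over all quadruples (n1, n2, n4, n5) of nonzero integers with n1 + n2 + n4 + n5 = 0 and n4 + n5 ≠ 0 equals 0. -/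
/-- A `finsum` over a set vanishes if a permutation preserving the set negates the summand. -/
theorem finsum_mem_eq_zero_of_comp_equiv_eq_neg {α : Type*} {s : Set α} {f : α → ℂ}
    (e : α ≃ α) (hs : ∀ x, e x ∈ s ↔ x ∈ s) (hf : ∀ x ∈ s, f (e x) = -f x) :
    ∑ᶠ x ∈ s, f x = 0 := by
  have h : ∑ᶠ x, s.indicator f x = -∑ᶠ x, s.indicator f x := by
    rw [← finsum_neg_distrib, ← finsum_comp_equiv e]
    refine finsum_congr fun x => ?_
    by_cases hx : x ∈ s
    · rw [Set.indicator_of_mem ((hs x).2 hx), Set.indicator_of_mem hx, hf x hx]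
    · rw [Set.indicator_of_notMem (mt (hs x).1 hx), Set.indicator_of_notMem hx, neg_zero]
  rw [finsum_mem_def]
  exact self_eq_neg.mp h

/-- The permutation `(n₁, n₂, n₄, n₅) ↦ (n₄, n₅, n₁, n₂)` exchanging the two pairs. -/
def swapPairs : ℤ × ℤ × ℤ × ℤ ≃ ℤ × ℤ × ℤ × ℤ where
  toFun t := (t.2.2.1, t.2.2.2, t.1, t.2.1)
  invFun t := (t.2.2.1, t.2.2.2, t.1, t.2.1)
  left_inv _ := rfl
  right_inv _ := rfl

/-- Cancellation of the "Decay of 0 resonance" remark: for any finitely supported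
a : ℤ → ℂ, the sum of a(n₁)a(n₂)a(n₄)a(n₅)/(n₁(n₄+n₅)n₄) over nonzero quadruples with
n₁ + n₂ + n₄ + n₅ = 0 and n₄ + n₅ ≠ 0 vanishes. -/
theorem decay_of_zero_resonance (a : ℤ → ℂ)
    (ha : (Function.support a).Finite) :
    (∑ᶠ t ∈ {t : ℤ × ℤ × ℤ × ℤ | t.1 ≠ 0 ∧ t.2.1 ≠ 0 ∧ t.2.2.1 ≠ 0 ∧ t.2.2.2 ≠ 0 ∧
        t.1 + t.2.1 + t.2.2.1 + t.2.2.2 = 0 ∧ t.2.2.1 + t.2.2.2 ≠ 0},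
      a t.1 * a t.2.1 * a t.2.2.1 * a t.2.2.2 /
        ((t.1 : ℂ) * ((t.2.2.1 : ℂ) + (t.2.2.2 : ℂ)) * (t.2.2.1 : ℂ))) = 0 := by
  refine finsum_mem_eq_zero_of_comp_equiv_eq_neg swapPairs ?_ ?_
  · rintro ⟨n₁, n₂, n₄, n₅⟩
    simp only [swapPairs, Equiv.coe_fn_mk, Set.mem_ofPred_eq]
    omega
  · rintro ⟨n₁, n₂, n₄, n₅⟩ ⟨-, -, -, -, hsum, -⟩
    simp only [swapPairs, Equiv.coe_fn_mk]
    have h : (n₁ : ℂ) + n₂ = -((n₄ : ℂ) + n₅) := by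
      have h₀ : (n₁ : ℂ) + n₂ + n₄ + n₅ = 0 := by exact_mod_cast hsum
      linear_combination h₀
    rw [h, ← div_neg]
    congr 1 <;> ring
end

section
/- For every real s > 1/2 and every ε with 0 ≤ ε ≤ 1 there exists a constant C > 0 with the following property. For every finitely supported function a : ℤ → [0,∞) with a(0) = 0, one has ( Σ_{n ≠ 0} ⟨n⟩^{2(s+ε)} · ( Σ_{n1+n2=n, n1≠0, n2≠0} |n|·(n1^2+n2^2) / |Φ2(n1,n2)| · a(n1)·a(n2) )^2 )^{1/2} ≤ C·Σ_n ⟨n⟩^{2s}·a(n)^2. -/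
/-- The multiplier of the quadratic boundary term is at most `(⟨n₁⟩⟨n₂⟩)⁻¹`. -/
lemma sq_multiplier_le {p q : ℤ} (hp : p ≠ 0) (hq : q ≠ 0) (hpq : p + q ≠ 0) :
    (|((p + q : ℤ) : ℝ)| * ((p : ℝ) ^ 2 + (q : ℝ) ^ 2) / |((Phi2 p q : ℤ) : ℝ)|) ^ 2 ≤
      ((1 + (p : ℝ) ^ 2) * (1 + (q : ℝ) ^ 2))⁻¹ := by
  have hp2 : (1 : ℝ) ≤ (p : ℝ) ^ 2 := by
    exact_mod_cast Int.one_le_abs (pow_ne_zero 2 hp) |>.trans_eq (abs_of_nonneg (sq_nonneg p))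
  have hq2 : (1 : ℝ) ≤ (q : ℝ) ^ 2 := by
    exact_mod_cast Int.one_le_abs (pow_ne_zero 2 hq) |>.trans_eq (abs_of_nonneg (sq_nonneg q))
  have hn : ((p : ℝ) + q) ≠ 0 := by exact_mod_cast hpq
  have hn2 : 0 < ((p : ℝ) + q) ^ 2 := by positivity
  have hfac : ((Phi2 p q : ℤ) : ℝ) =
      5 / 2 * (p + q) * p * q * (((p : ℝ) + q) ^ 2 + p ^ 2 + q ^ 2) := by
    simp only [Phi2]; push_cast; ring
  have hsq : (((Phi2 p q : ℤ) : ℝ)) ^ 2 =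
      25 / 4 * ((p : ℝ) + q) ^ 2 * p ^ 2 * q ^ 2 * (((p : ℝ) + q) ^ 2 + p ^ 2 + q ^ 2) ^ 2 := by
    rw [hfac]; ring
  rw [div_pow, mul_pow, sq_abs, sq_abs, hsq]
  push_cast
  generalize ((p : ℝ) + q) ^ 2 = N at *
  generalize (p : ℝ) ^ 2 = P at *
  generalize (q : ℝ) ^ 2 = Q at *
  rw [inv_eq_one_div, div_le_div_iff₀ (by positivity) (by positivity)]
  calc N * (P + Q) ^ 2 * ((1 + P) * (1 + Q))
      ≤ N * (N + P + Q) ^ 2 * ((P + P) * (Q + Q)) := by gcongr; linarith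
    _ = 4 * (N * P * Q * (N + P + Q) ^ 2) := by ring
    _ ≤ 1 * (25 / 4 * N * P * Q * (N + P + Q) ^ 2) := by
      have : 0 ≤ N * P * Q * (N + P + Q) ^ 2 := by positivity
      linarith

lemma rpow_one_add_sq_add_le {t : ℝ} (ht : 0 ≤ t) (x y : ℝ) :
    (1 + (x + y) ^ 2) ^ t ≤ 4 ^ t * ((1 + x ^ 2) ^ t + (1 + y ^ 2) ^ t) := by
  have key : 1 + (x + y) ^ 2 ≤ 4 * max (1 + x ^ 2) (1 + y ^ 2) := by
    have h1 := le_max_left (1 + x ^ 2) (1 + y ^ 2)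
    have h2 := le_max_right (1 + x ^ 2) (1 + y ^ 2)
    nlinarith [sq_nonneg (x - y)]
  have hX : (0 : ℝ) ≤ (1 + x ^ 2) ^ t := by positivity
  have hY : (0 : ℝ) ≤ (1 + y ^ 2) ^ t := by positivity
  calc (1 + (x + y) ^ 2) ^ t ≤ (4 * max (1 + x ^ 2) (1 + y ^ 2)) ^ t := by gcongr
    _ = 4 ^ t * (max (1 + x ^ 2) (1 + y ^ 2)) ^ t := by
      rw [Real.mul_rpow (by norm_num) (by positivity)]
    _ ≤ _ := by
      gcongr
      rcases max_choice (1 + x ^ 2) (1 + y ^ 2) with h | h <;> rw [h] <;> linarith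

lemma summable_inv_one_add_sq_int : Summable fun m : ℤ => (1 + (m : ℝ) ^ 2)⁻¹ := by
  refine (Real.summable_one_div_int_pow.2 one_lt_two).of_norm_bounded_eventually ?_
  rw [Filter.eventually_cofinite]
  refine (Set.finite_singleton (0 : ℤ)).subset fun m hm => ?_
  by_contra h
  refine hm ?_
  have : (0 : ℝ) < (m : ℝ) ^ 2 := by
    have : (m : ℝ) ≠ 0 := by exact_mod_cast h
    positivity
  rw [Real.norm_of_nonneg (by positivity), one_div]
  gcongr
  linarith

lemma sum_inv_one_add_sq_le_tsum {ι : Type*} (F : Finset ι) (f : ι → ℤ)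
    (hf : Set.InjOn f F) :
    ∑ i ∈ F, (1 + (f i : ℝ) ^ 2)⁻¹ ≤ ∑' m : ℤ, (1 + (m : ℝ) ^ 2)⁻¹ := by
  classical
  rw [← Finset.sum_image (f := fun m : ℤ => (1 + (m : ℝ) ^ 2)⁻¹) hf]
  exact summable_inv_one_add_sq_int.sum_le_tsum _ fun m _ => by positivity

/-- The weight `⟨n⟩^{2t} / (⟨n₁⟩^{2t}⟨n₂⟩^{2t})` has uniformly bounded sums over `n₁ + n₂ = n`. -/
lemma rpow_mul_sum_antidiagonal_le {t : ℝ} (ht : 1 ≤ t) (n : ℤ) (F : Finset (ℤ × ℤ))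
    (hF : ∀ p ∈ F, p.1 + p.2 = n) :
    (1 + (n : ℝ) ^ 2) ^ t *
        ∑ p ∈ F, ((1 + (p.1 : ℝ) ^ 2) ^ t * (1 + (p.2 : ℝ) ^ 2) ^ t)⁻¹ ≤
      4 ^ t * (2 * ∑' m : ℤ, (1 + (m : ℝ) ^ 2)⁻¹) := by
  have hinv (m : ℤ) : ((1 + (m : ℝ) ^ 2) ^ t)⁻¹ ≤ (1 + (m : ℝ) ^ 2)⁻¹ := by
    gcongr
    exact Real.self_le_rpow_of_one_le (by nlinarith) ht
  have hfst : Set.InjOn Prod.fst (F : Set (ℤ × ℤ)) := fun p hp q hq h => by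
    have := hF p hp
    have := hF q hq
    ext <;> lia
  have hsnd : Set.InjOn Prod.snd (F : Set (ℤ × ℤ)) := fun p hp q hq h => by
    have := hF p hp
    have := hF q hq
    ext <;> lia
  calc _ ≤ ∑ p ∈ F, 4 ^ t * ((1 + (p.1 : ℝ) ^ 2)⁻¹ + (1 + (p.2 : ℝ) ^ 2)⁻¹) := by
        rw [Finset.mul_sum]
        refine Finset.sum_le_sum fun p hp => ?_
        have hX : (0 : ℝ) < (1 + (p.1 : ℝ) ^ 2) ^ t := by positivity
        have hY : (0 : ℝ) < (1 + (p.2 : ℝ) ^ 2) ^ t := by positivity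
        have h := rpow_one_add_sq_add_le (zero_le_one.trans ht) (p.1 : ℝ) p.2
        rw [← hF p hp]
        push_cast
        calc _ ≤ 4 ^ t * ((1 + (p.1 : ℝ) ^ 2) ^ t + (1 + (p.2 : ℝ) ^ 2) ^ t) *
              ((1 + (p.1 : ℝ) ^ 2) ^ t * (1 + (p.2 : ℝ) ^ 2) ^ t)⁻¹ := by gcongr
          _ = 4 ^ t * (((1 + (p.1 : ℝ) ^ 2) ^ t)⁻¹ + ((1 + (p.2 : ℝ) ^ 2) ^ t)⁻¹) := by
            field_simp
            ring
          _ ≤ _ := mul_le_mul_of_nonneg_left (add_le_add (hinv _) (hinv _)) (by positivity)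
    _ ≤ _ := by
        rw [← Finset.mul_sum, Finset.sum_add_distrib, two_mul]
        gcongr
        · exact sum_inv_one_add_sq_le_tsum F _ hfst
        · exact sum_inv_one_add_sq_le_tsum F _ hsnd

lemma weighted_sq_sum_antidiagonal_le {s ε : ℝ} (hs : 0 ≤ s) (hε : ε ≤ 1) (a : ℤ → ℝ)
    {n : ℤ} (hn : n ≠ 0) (F : Finset (ℤ × ℤ))
    (hF : ∀ p ∈ F, p.1 ≠ 0 ∧ p.2 ≠ 0 ∧ p.1 + p.2 = n) :
    (1 + (n : ℝ) ^ 2) ^ (s + ε) *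
        (∑ p ∈ F, |(n : ℝ)| * ((p.1 : ℝ) ^ 2 + (p.2 : ℝ) ^ 2) /
          |((Phi2 p.1 p.2 : ℤ) : ℝ)| * a p.1 * a p.2) ^ 2 ≤
      4 ^ (s + 1) * (2 * ∑' m : ℤ, (1 + (m : ℝ) ^ 2)⁻¹) *
        ∑ p ∈ F, ((1 + (p.1 : ℝ) ^ 2) ^ s * a p.1 ^ 2) *
          ((1 + (p.2 : ℝ) ^ 2) ^ s * a p.2 ^ 2) := by
  have hcs : (∑ p ∈ F, |(n : ℝ)| * ((p.1 : ℝ) ^ 2 + (p.2 : ℝ) ^ 2) /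
          |((Phi2 p.1 p.2 : ℤ) : ℝ)| * a p.1 * a p.2) ^ 2 ≤
      (∑ p ∈ F, ((1 + (p.1 : ℝ) ^ 2) ^ (s + 1) * (1 + (p.2 : ℝ) ^ 2) ^ (s + 1))⁻¹) *
        ∑ p ∈ F, ((1 + (p.1 : ℝ) ^ 2) ^ s * a p.1 ^ 2) *
          ((1 + (p.2 : ℝ) ^ 2) ^ s * a p.2 ^ 2) := by
    refine Finset.sum_sq_le_sum_mul_sum_of_sq_le_mul F (fun p _ => by positivity)
      (fun p _ => by positivity) fun p hp => ?_
    obtain ⟨h1, h2, rfl⟩ := hF p hp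
    have hX : (0 : ℝ) < 1 + (p.1 : ℝ) ^ 2 := by positivity
    have hY : (0 : ℝ) < 1 + (p.2 : ℝ) ^ 2 := by positivity
    calc _ = (|((p.1 + p.2 : ℤ) : ℝ)| * ((p.1 : ℝ) ^ 2 + (p.2 : ℝ) ^ 2) /
            |((Phi2 p.1 p.2 : ℤ) : ℝ)|) ^ 2 * (a p.1 ^ 2 * a p.2 ^ 2) := by ring
      _ ≤ ((1 + (p.1 : ℝ) ^ 2) * (1 + (p.2 : ℝ) ^ 2))⁻¹ * (a p.1 ^ 2 * a p.2 ^ 2) := by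
        gcongr
        exact sq_multiplier_le h1 h2 hn
      _ = _ := by
        rw [Real.rpow_add_one hX.ne', Real.rpow_add_one hY.ne']
        have := Real.rpow_pos_of_pos hX s
        have := Real.rpow_pos_of_pos hY s
        field_simp
  calc _ ≤ (1 + (n : ℝ) ^ 2) ^ (s + 1) * _ := by
        gcongr
        nlinarith
    _ ≤ _ := mul_le_mul_of_nonneg_left hcs (by positivity)
    _ ≤ _ := by
        rw [← mul_assoc]
        refine mul_le_mul_of_nonneg_right ?_ (Finset.sum_nonneg fun p _ => by positivity)
        exact rpow_mul_sum_antidiagonal_le (by linarith) n F fun p hp => (hF p hp).2.2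

/-- Fourier-side content of the bound ‖B₁(u)‖_{H^{s+ε}} ≲ ‖u‖_{H^s}²: for s > 1/2 and
0 ≤ ε ≤ 1 there is C > 0 so that for every finitely supported a : ℤ → [0,∞) with
a(0) = 0,
( Σ_{n≠0} ⟨n⟩^{2(s+ε)} ( Σ_{n₁+n₂=n, n₁,n₂≠0} |n|(n₁²+n₂²)/|Φ₂(n₁,n₂)| a(n₁)a(n₂) )² )^{1/2}
  ≤ C·Σ_n ⟨n⟩^{2s} a(n)².  (Here ⟨n⟩^{2σ} = (1+n²)^σ.) -/
theorem B1_bound (s ε : ℝ) (hs : 1 / 2 < s) (hε0 : 0 ≤ ε) (hε1 : ε ≤ 1) :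
    ∃ C : ℝ, 0 < C ∧
      ∀ a : ℤ → ℝ, (Function.support a).Finite → (∀ n, 0 ≤ a n) → a 0 = 0 →
        Real.sqrt (∑ᶠ n ∈ {n : ℤ | n ≠ 0},
          (1 + (n : ℝ) ^ 2) ^ (s + ε) *
            (∑ᶠ p ∈ {p : ℤ × ℤ | p.1 ≠ 0 ∧ p.2 ≠ 0 ∧ p.1 + p.2 = n},
              |(n : ℝ)| * ((p.1 : ℝ) ^ 2 + (p.2 : ℝ) ^ 2) /
                  |((Phi2 p.1 p.2 : ℤ) : ℝ)| * a p.1 * a p.2) ^ 2) ≤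
        C * ∑ᶠ n : ℤ, (1 + (n : ℝ) ^ 2) ^ s * a n ^ 2 := by
  set Z : ℝ := ∑' m : ℤ, (1 + (m : ℝ) ^ 2)⁻¹
  have hZ : 0 < Z := summable_inv_one_add_sq_int.tsum_pos (fun m => by positivity) 0 (by simp)
  refine ⟨Real.sqrt (4 ^ (s + 1) * (2 * Z)), by positivity, fun a ha _ ha0 => ?_⟩
  set S : Finset ℤ := ha.toFinset
  have hmem {m : ℤ} (h : a m ≠ 0) : m ∈ S := ha.mem_toFinset.2 h
  have hne {m : ℤ} (h : m ∈ S) : m ≠ 0 := by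
    rintro rfl
    exact ha.mem_toFinset.1 h ha0
  set b : ℤ → ℝ := fun n => (1 + (n : ℝ) ^ 2) ^ s * a n ^ 2
  have hb (n : ℤ) : 0 ≤ b n := by positivity
  set T : Finset (ℤ × ℤ) := S ×ˢ S
  set U : Finset ℤ := T.image fun p => p.1 + p.2
  have hinner (n : ℤ) : (∑ᶠ p ∈ {p : ℤ × ℤ | p.1 ≠ 0 ∧ p.2 ≠ 0 ∧ p.1 + p.2 = n},
        |(n : ℝ)| * ((p.1 : ℝ) ^ 2 + (p.2 : ℝ) ^ 2) /
          |((Phi2 p.1 p.2 : ℤ) : ℝ)| * a p.1 * a p.2) =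
      ∑ p ∈ T with p.1 + p.2 = n, |(n : ℝ)| * ((p.1 : ℝ) ^ 2 + (p.2 : ℝ) ^ 2) /
          |((Phi2 p.1 p.2 : ℤ) : ℝ)| * a p.1 * a p.2 := by
    refine finsum_mem_eq_sum_of_inter_support_eq _ (Set.ext fun p => and_congr_left fun hp => ?_)
    have h1 : p.1 ∈ S := hmem (right_ne_zero_of_mul (left_ne_zero_of_mul hp))
    have h2 : p.2 ∈ S := hmem (right_ne_zero_of_mul hp)
    simp [T, h1, h2, hne h1, hne h2]
  have hrhs : ∑ᶠ n, b n = ∑ n ∈ S, b n :=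
    finsum_eq_sum_of_support_subset _ fun n hn =>
      hmem fun h => hn (by simp [b, h])
  simp only [hinner]
  rw [finsum_mem_eq_sum_of_inter_support_eq (t := U.filter (· ≠ 0)) _
    (Set.ext fun n => and_congr_left fun hn => ?_)]
  · rw [hrhs, Real.sqrt_le_left (by positivity), mul_pow, Real.sq_sqrt (by positivity)]
    calc _ ≤ ∑ n ∈ U with n ≠ 0, 4 ^ (s + 1) * (2 * Z) *
            ∑ p ∈ T with p.1 + p.2 = n, b p.1 * b p.2 := by
          refine Finset.sum_le_sum fun n hn => ?_
          refine weighted_sq_sum_antidiagonal_le (by linarith) hε1 a (Finset.mem_filter.1 hn).2 _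
            fun p hp => ?_
          obtain ⟨hpT, hpn⟩ := Finset.mem_filter.1 hp
          obtain ⟨h1, h2⟩ := Finset.mem_product.1 hpT
          exact ⟨hne h1, hne h2, hpn⟩
      _ ≤ 4 ^ (s + 1) * (2 * Z) * ∑ n ∈ U, ∑ p ∈ T with p.1 + p.2 = n, b p.1 * b p.2 := by
          rw [← Finset.mul_sum]
          refine mul_le_mul_of_nonneg_left ?_ (by positivity)
          exact Finset.sum_le_sum_of_subset_of_nonneg (Finset.filter_subset _ _) fun _ _ _ =>
            Finset.sum_nonneg fun p _ => mul_nonneg (hb _) (hb _)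
      _ = _ := by
          rw [Finset.sum_fiberwise_of_maps_to fun p hp => Finset.mem_image_of_mem _ hp,
            Finset.sum_product, sq, Finset.sum_mul_sum]
  · have hU : n ∈ U := by
      by_contra h
      refine hn ?_
      beta_reduce
      rw [Finset.sum_eq_zero, zero_pow two_ne_zero, mul_zero]
      intro p hp
      obtain ⟨hpT, hpn⟩ := Finset.mem_filter.1 hp
      exact absurd (Finset.mem_image.2 ⟨p, hpT, hpn⟩) h
    simp [hU]
end

section
/- For every real s > 1/2 and every ε with 0 ≤ ε ≤ 2s − 1 there exists a constant C > 0 with the following property. For every finitely supported function a : ℤ → [0,∞), one has ( Σ_{n ∈ ℤ} ⟨n⟩^{2(s+ε)} · n^2 · a(n)^4 · ( Σ_{n1+n2=−n} a(n1)·a(n2) )^2 )^{1/2} ≤ C·( Σ_n ⟨n⟩^{2s}·a(n)^2 )^2. -/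
/-- The Japanese bracket is submultiplicative up to a constant:
`⟨x + y⟩ ^ s ≤ 2 ^ (s / 2) ⟨x⟩ ^ s ⟨y⟩ ^ s`. -/
theorem one_add_sq_rpow_le {x y z t : ℝ} (ht : 0 ≤ t) (h : z = -(x + y)) :
    (1 + z ^ 2) ^ t ≤ 2 ^ t * (1 + x ^ 2) ^ t * (1 + y ^ 2) ^ t := by
  rw [← Real.mul_rpow (by positivity) (by positivity),
    ← Real.mul_rpow (by positivity) (by positivity)]
  refine Real.rpow_le_rpow (by positivity) ?_ ht
  subst h
  nlinarith [sq_nonneg (x - y), mul_nonneg (sq_nonneg x) (sq_nonneg y)]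

/-- Weighted pointwise bound for the self-convolution of a finitely supported sequence. -/
theorem rpow_mul_finsum_le {t : ℝ} (ht : 0 ≤ t) {a : ℤ → ℝ} (ha : (Function.support a).Finite)
    (ha0 : ∀ n, 0 ≤ a n) (n : ℤ) :
    (1 + (n : ℝ) ^ 2) ^ t * ∑ᶠ m : ℤ, a m * a (-n - m) ≤
      2 ^ t * ∑ᶠ m : ℤ, ((1 + (m : ℝ) ^ 2) ^ t * a m) ^ 2 := by
  set b : ℤ → ℝ := fun m => (1 + (m : ℝ) ^ 2) ^ t * a m with hb
  have hfb : (Function.support fun m => b m ^ 2).Finite := by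
    refine ha.subset fun m hm hm' => hm ?_
    simp [hb, hm']
  have hfc : (Function.support fun m => a m * a (-n - m)).Finite := by
    refine ha.subset fun m hm hm' => hm ?_
    simp [hm']
  have hfb' : (Function.support fun m => b (-n - m) ^ 2).Finite :=
    hfb.preimage (sub_right_injective.injOn)
  have hrefl : ∑ᶠ m, b (-n - m) ^ 2 = ∑ᶠ m, b m ^ 2 :=
    finsum_comp_equiv (Equiv.subLeft (-n)) (f := fun m => b m ^ 2)
  have hsum : ∑ᶠ m, (2 ^ t / 2) * (b m ^ 2 + b (-n - m) ^ 2) = 2 ^ t * ∑ᶠ m, b m ^ 2 := by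
    rw [← mul_finsum, finsum_add_distrib hfb hfb', hrefl]
    ring
  rw [← hsum, mul_finsum' _ _ hfc]
  refine finsum_le_finsum' ?_ ?_ fun m => ?_
  · refine hfc.subset fun m hm hm' => hm ?_
    simp only [hm', mul_zero]
  · refine (hfb.union hfb').subset fun m hm => Function.support_add _ _ fun hm' => hm ?_
    simp only [hm', mul_zero]
  have key := one_add_sq_rpow_le (x := (m : ℝ)) (y := ((-n - m : ℤ) : ℝ)) (z := (n : ℝ)) ht
    (by push_cast; ring)
  have h2 : (0 : ℝ) ≤ 2 ^ t := by positivity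
  calc _ ≤ (2 ^ t * (1 + (m : ℝ) ^ 2) ^ t * (1 + ((-n - m : ℤ) : ℝ) ^ 2) ^ t) *
        (a m * a (-n - m)) :=
        mul_le_mul_of_nonneg_right key (mul_nonneg (ha0 _) (ha0 _))
    _ = 2 ^ t * (b m * b (-n - m)) := by simp only [hb]; ring
    _ ≤ _ := by nlinarith [mul_nonneg h2 (sq_nonneg (b m - b (-n - m)))]

/-- Fourier-side content of the resonant term RE₂ estimate: for s > 1/2 and
0 ≤ ε ≤ 2s − 1 there is C > 0 so that for every finitely supported a : ℤ → [0,∞),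
( Σ_n ⟨n⟩^{2(s+ε)} n² a(n)⁴ ( Σ_{n₁+n₂=−n} a(n₁)a(n₂) )² )^{1/2}
  ≤ C·( Σ_n ⟨n⟩^{2s} a(n)² )².  (Here ⟨n⟩^{2σ} = (1+n²)^σ.) -/
theorem RE2_bound (s ε : ℝ) (hs : 1 / 2 < s) (hε0 : 0 ≤ ε) (hε1 : ε ≤ 2 * s - 1) :
    ∃ C : ℝ, 0 < C ∧
      ∀ a : ℤ → ℝ, (Function.support a).Finite → (∀ n, 0 ≤ a n) →
        Real.sqrt (∑ᶠ n : ℤ,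
          (1 + (n : ℝ) ^ 2) ^ (s + ε) * (n : ℝ) ^ 2 * a n ^ 4 *
            (∑ᶠ m : ℤ, a m * a (-n - m)) ^ 2) ≤
        C * (∑ᶠ n : ℤ, (1 + (n : ℝ) ^ 2) ^ s * a n ^ 2) ^ 2 := by
  refine ⟨2 ^ (s / 2), by positivity, fun a ha ha0 => ?_⟩
  have hw (n : ℤ) : (1 + (n : ℝ) ^ 2) ^ s = ((1 + (n : ℝ) ^ 2) ^ (s / 2)) ^ 2 := by
    rw [← Real.rpow_mul_natCast (by positivity)]
    congr 1
    push_cast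
    ring
  set A : ℝ := ∑ᶠ n : ℤ, (1 + (n : ℝ) ^ 2) ^ s * a n ^ 2 with hA
  have hfA : (Function.support fun n : ℤ => (1 + (n : ℝ) ^ 2) ^ s * a n ^ 2).Finite := by
    refine ha.subset fun m hm hm' => hm ?_
    simp [hm']
  have hA0 : 0 ≤ A := finsum_nonneg fun n => by positivity
  have hconv (n : ℤ) : (1 + (n : ℝ) ^ 2) ^ s * (∑ᶠ m : ℤ, a m * a (-n - m)) ^ 2 ≤
      (2 ^ (s / 2) * A) ^ 2 := by
    have h := rpow_mul_finsum_le (t := s / 2) (by linarith) ha ha0 n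
    simp only [mul_pow _ (a _), ← hw, ← hA] at h
    rw [hw, ← mul_pow]
    exact pow_le_pow_left₀ (mul_nonneg (by positivity)
      (finsum_nonneg fun m => mul_nonneg (ha0 _) (ha0 _))) h 2
  refine Real.sqrt_le_iff.mpr ⟨by positivity, ?_⟩
  have hsum : ∑ᶠ n : ℤ, (A * (2 ^ (s / 2) * A) ^ 2) * ((1 + (n : ℝ) ^ 2) ^ s * a n ^ 2) =
      (2 ^ (s / 2) * A ^ 2) ^ 2 := by
    rw [← mul_finsum' _ _ hfA, ← hA]
    ring
  rw [← hsum]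
  refine finsum_le_finsum' ?_ ?_ fun n => ?_
  · refine ha.subset fun m hm hm' => hm ?_
    simp [hm']
  · refine ha.subset fun m hm hm' => hm ?_
    simp [hm']
  have hterm : (1 + (n : ℝ) ^ 2) ^ s * a n ^ 2 ≤ A :=
    single_le_finsum n hfA fun m => by positivity
  have hweight : (1 + (n : ℝ) ^ 2) ^ (s + ε) * (n : ℝ) ^ 2 ≤ ((1 + (n : ℝ) ^ 2) ^ s) ^ 3 := by
    calc _ ≤ (1 + (n : ℝ) ^ 2) ^ (s + ε) * (1 + (n : ℝ) ^ 2) := by gcongr; linarith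
      _ = (1 + (n : ℝ) ^ 2) ^ (s + ε + 1) := by
        rw [Real.rpow_add_one (by positivity)]
      _ ≤ (1 + (n : ℝ) ^ 2) ^ (s * (3 : ℕ)) :=
        Real.rpow_le_rpow_of_exponent_le (by nlinarith [sq_nonneg (n : ℝ)])
          (by push_cast; linarith)
      _ = _ := Real.rpow_mul_natCast (by positivity) _ _
  calc _ ≤ ((1 + (n : ℝ) ^ 2) ^ s) ^ 3 * a n ^ 4 * (∑ᶠ m : ℤ, a m * a (-n - m)) ^ 2 := by
        gcongr
    _ = ((1 + (n : ℝ) ^ 2) ^ s * a n ^ 2) *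
        ((1 + (n : ℝ) ^ 2) ^ s * (∑ᶠ m : ℤ, a m * a (-n - m)) ^ 2) *
        ((1 + (n : ℝ) ^ 2) ^ s * a n ^ 2) := by ring
    _ ≤ _ := by
        gcongr
        exact hconv n
end
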